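/- arXiv:0804.1395 — 2 statements merged into one kernel-verified Lean document; each statement's English description precedes it below -/
import Mathlib

section
/- For all integers d, k ≥ 1 there exists a set S of polynomials in k·d² complex variables (the entries of a k-tuple of d×d matrices) such that for every tuple (a_1, …, a_k) ∈ GL_d(ℂ)^k, the subgroup of GL_d(ℂ) generated by a_1, …, a_k is virtually solvable if and only if every polynomial in S vanishes at the tuple of matrix entries of (a_1, …, a_k). In other words, the set of k-tuples in GL_d(ℂ)^k generating a virtually solvable subgroup is Zariski-closed in GL_d(ℂ)^k. -/
open scoped MatrixGroups

set_option linter.unusedSectionVars false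

section Jordan
variable {E : Type*} [NormedAddCommGroup E] [InnerProductSpace ℂ E] [FiniteDimensional ℂ E]
  [CompleteSpace E]

lemma exists_eigen_of_normal (D : E →L[ℂ] E) [IsStarNormal D] (hD : D ≠ 0) :
    ∃ ν : ℂ, ν ≠ 0 ∧ Module.End.HasEigenvalue (D : E →ₗ[ℂ] E) ν := by
  have : Nontrivial (E →L[ℂ] E) := ⟨D, 0, hD⟩
  obtain ⟨ν, h1, h2⟩ := spectrum.exists_nnnorm_eq_spectralRadius D
  rw [IsStarNormal.spectralRadius_eq_nnnorm] at h2
  refine ⟨ν, ?_, ?_⟩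
  · rintro rfl
    apply hD
    simpa using h2.symm
  · rw [Module.End.hasEigenvalue_iff_mem_spectrum]
    have := AlgEquiv.spectrum_eq (Module.End.toContinuousLinearMap E) (D : E →ₗ[ℂ] E)
    rw [← this]
    exact h1
    

lemma frob (A B : unitary (E →L[ℂ] E)) (hB : ‖(B : E →L[ℂ] E) - 1‖ < 1)
    (h : Commute A (A * B * A⁻¹ * B⁻¹)) : Commute A B := by
  set A' := B * A * B⁻¹ with hA'
  have hc : Commute A A' := by
    have h2 : Commute A (A * B * A⁻¹ * B⁻¹)⁻¹ := h.inv_right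
    have h3 := h2.mul_right (Commute.refl A)
    have : (A * B * A⁻¹ * B⁻¹)⁻¹ * A = A' := by simp [hA']; group
    rwa [this] at h3
  have hcc : Commute (A : E →L[ℂ] E) (A' : E →L[ℂ] E) := by
    have := congrArg (Subtype.val) hc.eq
    exact this
  suffices hh : A' = A by
    rw [hA', mul_inv_eq_iff_eq_mul] at hh
    exact hh.symm
  by_contra hne
  set D : E →L[ℂ] E := A' - A with hD
  have hD0 : D ≠ 0 := by
    intro h0
    apply hne
    exact Subtype.ext (sub_eq_zero.mp h0)
  have e1 : Commute (A' : E →L[ℂ] E) (star (A : E →L[ℂ] E)) := by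
    have := congrArg (Subtype.val) (hc.inv_left).symm.eq
    exact this
  have e2 : Commute (A : E →L[ℂ] E) (star (A' : E →L[ℂ] E)) := by
    have := congrArg (Subtype.val) (hc.inv_right).eq
    exact this
  have e3 : ∀ U : unitary (E →L[ℂ] E), Commute (U : E →L[ℂ] E) (star (U : E →L[ℂ] E)) := by
    intro U
    show _ * _ = _ * _
    rw [Unitary.mul_star_self_of_mem U.2, Unitary.star_mul_self_of_mem U.2]
  have : IsStarNormal D := ⟨by
    rw [hD, star_sub]
    refine Commute.symm ?_
    exact ((e3 A').sub_left e2).sub_right (e1.sub_left (e3 A))⟩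
  obtain ⟨ν, hν, hev⟩ := exists_eigen_of_normal D hD0
  have hAD : Commute (A : E →L[ℂ] E) D := hcc.sub_right (Commute.refl _)
  -- A preserves eigenspace
  set W := Module.End.eigenspace (D : E →ₗ[ℂ] E) ν with hW
  have hmap : ∀ x ∈ W, ((A : E →L[ℂ] E) : E →ₗ[ℂ] E) x ∈ W := by
    intro x hx
    rw [hW, Module.End.mem_eigenspace_iff] at hx ⊢
    have := congrArg (fun T : E →L[ℂ] E => T x) hAD.eq
    simp only [mul_apply_eq_comp] at this
    simp only [ContinuousLinearMap.coe_coe] at hx ⊢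
    rw [← this, hx, map_smul]
  have : Nontrivial W := by
    rw [Submodule.nontrivial_iff_ne_bot]
    exact hev
  obtain ⟨μ, hμ⟩ := Module.End.exists_eigenvalue (((A : E →L[ℂ] E) : E →ₗ[ℂ] E).restrict hmap)
  obtain ⟨v, hv⟩ := hμ.exists_hasEigenvector
  have hv1 := hv.apply_eq_smul
  have hv0 := hv.2
  have hAv : (A : E →L[ℂ] E) v = μ • (v : E) := congrArg Subtype.val hv1
  have hDv : D (v : E) = ν • (v : E) := Module.End.mem_eigenspace_iff.mp v.2
  have hA'v : (A' : E →L[ℂ] E) v = (μ + ν) • (v : E) := by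
    rw [add_smul, ← hAv, ← hDv, hD]; simp
  have hvne : (v : E) ≠ 0 := by simpa using hv0
  set w : E := ((B⁻¹ : unitary (E →L[ℂ] E)) : E →L[ℂ] E) v with hw
  have hBw : (B : E →L[ℂ] E) w = v := by
    rw [hw, ← mul_apply_eq_comp]
    have : (B : E →L[ℂ] E) * ((B⁻¹ : unitary (E →L[ℂ] E)) : E →L[ℂ] E) = 1 := by
      rw [← Submonoid.coe_mul]; simp
    rw [this]; rfl
  have hAw : (A : E →L[ℂ] E) w = (μ + ν) • w := by
    have h1 : B⁻¹ * A' = A * B⁻¹ := by rw [hA']; group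
    have h2 := congrArg (fun T : unitary (E →L[ℂ] E) => (T : E →L[ℂ] E) v) h1
    simp only [Submonoid.coe_mul, mul_apply_eq_comp, hA'v, map_smul] at h2
    rw [hw, ← h2]
  have hin : ∀ (U : unitary (E →L[ℂ] E)) (x y : E), inner ℂ ((U : E →L[ℂ] E) x) ((U : E →L[ℂ] E) y) = inner ℂ x y := by
    intro U x y
    exact ContinuousLinearMap.inner_map_map_of_mem_unitary U.2 x y
  have hnorm : ∀ (U : unitary (E →L[ℂ] E)) (x : E), ‖(U : E →L[ℂ] E) x‖ = ‖x‖ := by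
    intro U x
    exact ContinuousLinearMap.norm_map_of_mem_unitary U.2 x
  have hμ1 : ‖μ‖ = 1 := by
    have := hnorm A v
    rw [hAv, norm_smul] at this
    exact mul_right_cancel₀ (norm_ne_zero_iff.mpr hvne) (by rw [this, one_mul])
  have horth : inner ℂ (v : E) w = 0 := by
    have := hin A v w
    rw [hAv, hAw, inner_smul_left, inner_smul_right, ← mul_assoc] at this
    have hm : (starRingEnd ℂ) μ * μ = 1 := by
      rw [Complex.conj_mul', hμ1]; simp
    rw [mul_add, hm, add_mul, one_mul, add_eq_left] at this
    rcases mul_eq_zero.mp this with h | h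
    · rcases mul_eq_zero.mp h with h | h
      · simp only [map_eq_zero] at h
        rw [h] at hμ1; simp at hμ1
      · exact absurd h hν
    · exact h
  have hlt : ‖(v : E) - w‖ < ‖w‖ := by
    have hw0 : 0 < ‖w‖ := by
      rw [hw, hnorm]; exact norm_pos_iff.mpr hvne
    calc ‖(v : E) - w‖ = ‖((B : E →L[ℂ] E) - 1) w‖ := by simp [hBw]
      _ ≤ ‖(B : E →L[ℂ] E) - 1‖ * ‖w‖ := ContinuousLinearMap.le_opNorm _ _
      _ < 1 * ‖w‖ := by gcongr
      _ = ‖w‖ := one_mul _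
  have := norm_sub_sq (𝕜 := ℂ) (v : E) w
  rw [horth] at this
  simp at this
  nlinarith [norm_nonneg (v : E), norm_nonneg w, norm_nonneg ((v : E) - w), sq_nonneg ‖(v : E)‖]



lemma norm_comm_sub_one (a b : unitary (E →L[ℂ] E)) :
    ‖((a * b * a⁻¹ * b⁻¹ : unitary (E →L[ℂ] E)) : E →L[ℂ] E) - 1‖ ≤
      2 * ‖(a : E →L[ℂ] E) - 1‖ * ‖(b : E →L[ℂ] E) - 1‖ := by
  have key : ((a * b * a⁻¹ * b⁻¹ : unitary (E →L[ℂ] E)) : E →L[ℂ] E) - 1 =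
      (((a : E →L[ℂ] E) - 1) * ((b : E →L[ℂ] E) - 1) - ((b : E →L[ℂ] E) - 1) * ((a : E →L[ℂ] E) - 1))
        * ((a⁻¹ * b⁻¹ : unitary (E →L[ℂ] E)) : E →L[ℂ] E) := by
    have h1 : (((b * a) * (a⁻¹ * b⁻¹) : unitary (E →L[ℂ] E)) : E →L[ℂ] E) = 1 := by
      have : (b * a) * (a⁻¹ * b⁻¹) = 1 := by group
      rw [this]; rfl
    have h2 : (((a : E →L[ℂ] E) - 1) * ((b : E →L[ℂ] E) - 1) -
        ((b : E →L[ℂ] E) - 1) * ((a : E →L[ℂ] E) - 1)) = (a : E →L[ℂ] E) * b - b * a := by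
      noncomm_ring
    rw [h2, ← h1]
    simp only [Submonoid.coe_mul]
    noncomm_ring
  rw [key, CStarRing.norm_mul_coe_unitary]
  calc _ ≤ ‖((a : E →L[ℂ] E) - 1) * ((b : E →L[ℂ] E) - 1)‖ + ‖((b : E →L[ℂ] E) - 1) * ((a : E →L[ℂ] E) - 1)‖ :=
        norm_sub_le _ _
    _ ≤ ‖(a : E →L[ℂ] E) - 1‖ * ‖(b : E →L[ℂ] E) - 1‖ + ‖(b : E →L[ℂ] E) - 1‖ * ‖(a : E →L[ℂ] E) - 1‖ := by
        gcongr <;> exact norm_mul_le _ _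
    _ = _ := by ring

def commSeq {G : Type*} [Group G] (g h : G) : ℕ → G
  | 0 => h
  | (k+1) => g * commSeq g h k * g⁻¹ * (commSeq g h k)⁻¹

lemma near_commute {G : Type*} [Group G] (u : G →* unitary (E →L[ℂ] E)) (H : Subgroup G)
    [H.FiniteIndex] (hH : ∀ h ∈ H, ∃ c : ℂ, (u h : E →L[ℂ] E) = c • 1) (g h : G)
    (hg : ‖(u g : E →L[ℂ] E) - 1‖ ≤ 1/4) (hh : ‖(u h : E →L[ℂ] E) - 1‖ ≤ 1/4) :
    Commute (u g) (u h) := by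
  have hb : ∀ k, ‖(u (commSeq g h k) : E →L[ℂ] E) - 1‖ ≤ 1/4 * (1/2)^k := by
    intro k
    induction k with
    | zero => simpa [commSeq] using hh
    | succ k ih =>
      have := norm_comm_sub_one (u g) (u (commSeq g h k))
      rw [← map_inv, ← map_inv, ← map_mul, ← map_mul, ← map_mul] at this
      calc _ ≤ _ := this
        _ ≤ 2 * (1/4) * (1/4 * (1/2)^k) := by gcongr
        _ = _ := by ring
  have hlim : Filter.Tendsto (fun k => (u (commSeq g h k) : E →L[ℂ] E)) Filter.atTop (nhds 1) := by
    rw [tendsto_iff_norm_sub_tendsto_zero]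
    refine squeeze_zero (fun _ => norm_nonneg _) hb ?_
    have := (tendsto_pow_atTop_nhds_zero_of_lt_one (r := (1/2 : ℝ)) (by norm_num) (by norm_num)).const_mul (1/4)
    simpa using this
  have hdesc : ∀ k, Commute (u g) (u (commSeq g h k)) → Commute (u g) (u (commSeq g h 0)) := by
    intro k
    induction k with
    | zero => exact id
    | succ k ih =>
      intro hc
      apply ih
      apply frob
      · calc _ ≤ _ := hb k
          _ ≤ 1/4 * 1 := by gcongr; exact pow_le_one₀ (by norm_num) (by norm_num)
          _ < 1 := by norm_num
      · simpa [commSeq] using hc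
  obtain ⟨q, hq⟩ := Finite.exists_infinite_fiber (fun k : ℕ => (QuotientGroup.mk (commSeq g h k) : G ⧸ H))
  have hq' := Set.infinite_coe_iff.mp hq
  obtain ⟨k, hk⟩ := hq'.nonempty
  apply hdesc k
  have hfreq : ∃ᶠ k' in Filter.atTop, (u (commSeq g h k') : E →L[ℂ] E) ∈ (Submodule.span ℂ {(u (commSeq g h k) : E →L[ℂ] E)} : Set (E →L[ℂ] E)) := by
    rw [Nat.frequently_atTop_iff_infinite]
    refine hq'.mono ?_
    intro k' hk'
    have e : (QuotientGroup.mk (commSeq g h k) : G ⧸ H) = QuotientGroup.mk (commSeq g h k') := by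
      simp only [Set.mem_preimage, Set.mem_singleton_iff] at hk hk'
      rw [hk, hk']
    rw [QuotientGroup.eq] at e
    obtain ⟨c, hc⟩ := hH _ e
    simp only [Set.mem_ofPred_eq, SetLike.mem_coe]
    rw [Submodule.mem_span_singleton]
    refine ⟨c, ?_⟩
    have : (u (commSeq g h k') : E →L[ℂ] E) = u (commSeq g h k) * u ((commSeq g h k)⁻¹ * commSeq g h k') := by
      rw [← Submonoid.coe_mul, ← map_mul]; simp
    rw [this, hc]; simp
  have h1 := (Submodule.closed_of_finiteDimensional (Submodule.span ℂ {(u (commSeq g h k) : E →L[ℂ] E)})).mem_of_frequently_of_tendsto hfreq hlim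
  simp only [SetLike.mem_coe] at h1
  rw [Submodule.mem_span_singleton] at h1
  obtain ⟨c, hc⟩ := h1
  apply Subtype.ext
  have e1 : (u (commSeq g h k) : E →L[ℂ] E) = (c • (u (commSeq g h k) : E →L[ℂ] E)) * (u (commSeq g h k) : E →L[ℂ] E) := by rw [hc, one_mul]
  by_cases hc0 : c = 0
  · rw [hc0, zero_smul] at hc
    have : ∀ T S: E →L[ℂ] E, T = S := fun T S => by rw [← one_mul T, ← one_mul S, ← hc]; simp
    exact this _ _
  · have : (u (commSeq g h k) : E →L[ℂ] E) = c⁻¹ • 1 := by rw [← hc, smul_smul, inv_mul_cancel₀ hc0, one_smul]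
    simp [Submonoid.coe_mul, this]

lemma index_le_of_color {G : Type*} [Group G] (K : Subgroup G) {ι : Type*} [Finite ι] (f : G → ι)
    (hf : ∀ g h, f g = f h → g⁻¹ * h ∈ K) : K.index ≠ 0 ∧ K.index ≤ Nat.card ι := by
  have hinj : Function.Injective (fun q : G ⧸ K => f q.out) := by
    intro q r hqr
    have := hf _ _ hqr
    rw [← QuotientGroup.eq] at this
    simpa using this
  have : Finite (G ⧸ K) := Finite.of_injective _ hinj
  refine ⟨?_, Nat.card_le_card_of_injective _ hinj⟩
  exact Nat.card_pos.ne'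

lemma commute_closure {G M : Type*} [Group G] [Monoid M] (u : G →* M) (S : Set G)
    (h : ∀ x ∈ S, ∀ y ∈ S, Commute (u x) (u y)) :
    ∀ x ∈ Subgroup.closure S, ∀ y ∈ Subgroup.closure S, Commute (u x) (u y) := by
  intro x hx y hy
  induction hx, hy using Subgroup.closure_induction₂ with
  | mem x y hx hy => exact h x hx y hy
  | one_left x hx => simp
  | one_right x hx => simp
  | mul_left x y z hx hy hz h1 h2 => rw [map_mul]; exact h1.mul_left h2
  | mul_right x y z hx hy hz h1 h2 => rw [map_mul]; exact h1.mul_right h2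
  | inv_left x y hx hy h1 =>
    have := (h1 : SemiconjBy _ _ _)
    show u x⁻¹ * u y = u y * u x⁻¹
    have e : u x⁻¹ * (u y * u x) * u x⁻¹ = u x⁻¹ * (u x * u y) * u x⁻¹ := by rw [h1.eq]
    have i1 : u x * u x⁻¹ = 1 := by rw [← map_mul]; simp
    have i2 : u x⁻¹ * u x = 1 := by rw [← map_mul]; simp
    rw [← mul_assoc (u x⁻¹) (u x), i2, one_mul, ← mul_assoc, mul_assoc _ (u x), i1, mul_one] at e
    exact e
  | inv_right x y hx hy h1 =>
    show u x * u y⁻¹ = u y⁻¹ * u x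
    have e : u y⁻¹ * (u y * u x) * u y⁻¹ = u y⁻¹ * (u x * u y) * u y⁻¹ := by rw [h1.eq]
    have i1 : u y * u y⁻¹ = 1 := by rw [← map_mul]; simp
    have i2 : u y⁻¹ * u y = 1 := by rw [← map_mul]; simp
    rw [← mul_assoc (u y⁻¹) (u y), i2, one_mul, ← mul_assoc, mul_assoc _ (u y), i1, mul_one] at e
    exact e

variable (E) in
lemma jordan_unitary : ∃ J : ℕ, ∀ (G : Type) [Group G] (u : G →* unitary (E →L[ℂ] E)) (H : Subgroup G)
    [H.FiniteIndex], (∀ h ∈ H, ∃ c : ℂ, (u h : E →L[ℂ] E) = c • 1) →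
    ∃ K : Subgroup G, K.index ≠ 0 ∧ K.index ≤ J ∧ ∀ x ∈ K, ∀ y ∈ K, Commute (u x) (u y) := by
  have : ProperSpace (E →L[ℂ] E) := FiniteDimensional.proper ℂ _
  have htb : TotallyBounded (Metric.closedBall (0 : E →L[ℂ] E) 1) := (isCompact_closedBall _ _).totallyBounded
  rw [Metric.totallyBounded_iff] at htb
  obtain ⟨t, ht, hcov⟩ := htb (1/8) (by norm_num)
  have : Finite t := ht
  refine ⟨Nat.card t, ?_⟩
  intro G _ u H _ hH
  have hmem : ∀ g, ∃ y : t, dist (u g : E →L[ℂ] E) y < 1/8 := by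
    intro g
    have : (u g : E →L[ℂ] E) ∈ Metric.closedBall (0 : E →L[ℂ] E) 1 := by
      rw [mem_closedBall_zero_iff]
      exact ContinuousLinearMap.opNorm_le_bound _ zero_le_one (fun x => by
        rw [ContinuousLinearMap.norm_map_of_mem_unitary (u g).2, one_mul])
    have := hcov this
    simp only [Set.mem_iUnion] at this
    obtain ⟨y, hy, h⟩ := this
    exact ⟨⟨y, hy⟩, h⟩
  choose f hf using hmem
  set S : Set G := {g | ‖(u g : E →L[ℂ] E) - 1‖ ≤ 1/4} with hS
  obtain ⟨h1, h2⟩ := index_le_of_color (Subgroup.closure S) f (by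
    intro g h hgh
    apply Subgroup.subset_closure
    show ‖(u (g⁻¹ * h) : E →L[ℂ] E) - 1‖ ≤ 1/4
    have e : (u (g⁻¹ * h) : E →L[ℂ] E) - 1 = (u g⁻¹ : E →L[ℂ] E) * (u h - u g) := by
      have i1 : (u g⁻¹ : E →L[ℂ] E) * u g = 1 := by rw [← Submonoid.coe_mul, ← map_mul]; simp
      rw [mul_sub, i1, map_mul, Submonoid.coe_mul]
    rw [e, CStarRing.norm_coe_unitary_mul, ← dist_eq_norm]
    have := hf g
    have h3 := hf h
    rw [← hgh] at h3
    have := dist_triangle_right (u h : E →L[ℂ] E) (u g) (f g)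
    linarith)
  refine ⟨_, h1, h2, commute_closure u S ?_⟩
  intro x hx y hy
  exact near_commute u H hH x y hx hy

end Jordan


section JordanMatrix
open Matrix
open scoped ComplexOrder

lemma unitarize {n : ℕ} {G : Type} [Group G] (ψ : G →* Matrix (Fin n) (Fin n) ℂ) (H : Subgroup G)
    [H.FiniteIndex] (hH : ∀ h ∈ H, ∃ c : ℂ, ‖c‖ = 1 ∧ ψ h = c • 1) :
    ∃ R : (Matrix (Fin n) (Fin n) ℂ)ˣ, ∀ g, (R : Matrix (Fin n) (Fin n) ℂ) * ψ g * (R⁻¹ : (Matrix (Fin n) (Fin n) ℂ)ˣ)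
      ∈ unitary (Matrix (Fin n) (Fin n) ℂ) := by
  classical
  have : Fintype (G ⧸ H) := Fintype.ofFinite _
  set f : G → Matrix (Fin n) (Fin n) ℂ := fun x => (ψ x⁻¹)ᴴ * ψ x⁻¹ with hf
  have hi1 : ∀ g, ψ g * ψ g⁻¹ = 1 := fun g => by rw [← map_mul]; simp
  have hi2 : ∀ g, ψ g⁻¹ * ψ g = 1 := fun g => by rw [← map_mul]; simp
  have hcoset : ∀ x y : G, (QuotientGroup.mk x : G ⧸ H) = QuotientGroup.mk y → f x = f y := by
    intro x y hxy
    rw [QuotientGroup.eq] at hxy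
    obtain ⟨c, hc, hcx⟩ := hH _ (H.inv_mem hxy)
    have : ψ y⁻¹ = c • ψ x⁻¹ := by
      have : ψ y⁻¹ = ψ (x⁻¹ * y)⁻¹ * ψ x⁻¹ := by rw [← map_mul]; simp
      rw [this, hcx]; simp
    simp only [hf]
    rw [this, conjTranspose_smul, smul_mul_smul_comm]
    have : star c * c = 1 := by
      have := Complex.conj_mul' c
      rw [hc] at this
      simpa using this
    rw [this, one_smul]
  set P : Matrix (Fin n) (Fin n) ℂ := ∑ q : G ⧸ H, f q.out with hP
  have hfpos : ∀ x, (f x).PosDef := by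
    intro x
    apply Matrix.PosDef.conjTranspose_mul_self
    apply Matrix.mulVec_injective_of_isUnit
    exact ⟨⟨_, _, hi2 x, hi1 x⟩, rfl⟩
  have hPpos : P.PosDef := by
    rw [hP]
    exact Matrix.posDef_sum (Finset.univ_nonempty) (fun q _ => hfpos _)
  have hinv : ∀ k, (ψ k)ᴴ * P * ψ k = P := by
    intro k
    rw [hP, Finset.mul_sum, Finset.sum_mul]
    refine Fintype.sum_equiv (MulAction.toPerm (k⁻¹ : G)) _ _ ?_
    intro q
    have e1 : (ψ k)ᴴ * f q.out * ψ k = f (k⁻¹ * q.out) := by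
      simp only [hf]
      rw [_root_.mul_inv_rev, inv_inv, map_mul, conjTranspose_mul]
      simp only [Matrix.mul_assoc]
    rw [e1]
    apply hcoset
    simp only [MulAction.toPerm_apply, Quotient.out_eq']
    rw [← smul_eq_mul, ← MulAction.Quotient.smul_mk, QuotientGroup.out_eq']
  obtain ⟨R, hR, hRP⟩ : ∃ R : Matrix (Fin n) (Fin n) ℂ, IsUnit R ∧ P = Rᴴ * R := by
    open scoped MatrixOrder in
    obtain ⟨y, hy, h⟩ := CStarAlgebra.isStrictlyPositive_iff_eq_star_mul_self.mp hPpos.isStrictlyPositive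
    exact ⟨y, hy, h⟩
  obtain ⟨R, rfl⟩ := hR
  refine ⟨R, fun g => ?_⟩
  have hone : star ((R : Matrix (Fin n) (Fin n) ℂ) * ψ g * (R⁻¹ : (Matrix (Fin n) (Fin n) ℂ)ˣ)) * ((R : Matrix (Fin n) (Fin n) ℂ) * ψ g * (R⁻¹ : (Matrix (Fin n) (Fin n) ℂ)ˣ)) = 1 := by
    have h1 := hinv g
    rw [hRP] at h1
    rw [star_mul, star_mul]
    simp only [star_eq_conjTranspose]
    calc _ = ((R⁻¹ : (Matrix (Fin n) (Fin n) ℂ)ˣ) : Matrix (Fin n) (Fin n) ℂ)ᴴ * ((ψ g)ᴴ * ((R : Matrix (Fin n) (Fin n) ℂ)ᴴ * R) * ψ g) * (R⁻¹ : (Matrix (Fin n) (Fin n) ℂ)ˣ) := by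
          simp only [Matrix.mul_assoc]
      _ = (((R : Matrix (Fin n) (Fin n) ℂ)) * ((R⁻¹ : (Matrix (Fin n) (Fin n) ℂ)ˣ) : Matrix (Fin n) (Fin n) ℂ))ᴴ * (R * (R⁻¹ : (Matrix (Fin n) (Fin n) ℂ)ˣ)) := by
          rw [h1, conjTranspose_mul]; simp only [Matrix.mul_assoc]
      _ = 1 := by simp
  exact mem_unitaryGroup_iff'.mpr hone

lemma jordan_matrix (n : ℕ) : ∃ J : ℕ, ∀ (G : Type) [Group G] (φ : G →* Matrix (Fin n) (Fin n) ℂ) (H : Subgroup G)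
    [H.FiniteIndex], (∀ h ∈ H, ∃ c : ℂ, φ h = c • 1) →
    ∃ K : Subgroup G, K.index ≠ 0 ∧ K.index ≤ J ∧ ∀ x ∈ K, ∀ y ∈ K, Commute (φ x) (φ y) := by
  rcases Nat.eq_zero_or_pos n with rfl | hn
  · refine ⟨1, fun G _ φ H _ _ => ⟨⊤, by simp, by simp, fun x _ y _ => Subsingleton.elim _ _⟩⟩
  obtain ⟨J, hJ⟩ := jordan_unitary (EuclideanSpace ℂ (Fin n))
  refine ⟨J, fun G _ φ H _ hH => ?_⟩
  have hdet0 : ∀ g, (φ g).det ≠ 0 := by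
    intro g h0
    have : (φ g * φ g⁻¹).det = 1 := by rw [← map_mul]; simp
    rw [det_mul, h0, zero_mul] at this
    exact zero_ne_one this
  set t : G → ℝ := fun g => ‖(φ g).det‖ ^ (-(1 / n : ℝ)) with ht
  have htpos : ∀ g, 0 < t g := fun g => Real.rpow_pos_of_pos (norm_pos_iff.mpr (hdet0 g)) _
  have htmul : ∀ g h, t (g * h) = t g * t h := by
    intro g h
    simp only [ht]
    rw [map_mul, det_mul, norm_mul, Real.mul_rpow (norm_nonneg _) (norm_nonneg _)]
  have ht1 : t 1 = 1 := by simp [ht]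
  have htn : ∀ g, t g ^ n * ‖(φ g).det‖ = 1 := by
    intro g
    have hp := norm_pos_iff.mpr (hdet0 g)
    simp only [ht]
    rw [← Real.rpow_natCast, ← Real.rpow_mul (norm_nonneg _)]
    have : -(1 / (n:ℝ)) * n = -1 := by field_simp
    rw [this, Real.rpow_neg_one, inv_mul_cancel₀ hp.ne']
  let ψ : G →* Matrix (Fin n) (Fin n) ℂ :=
    { toFun := fun g => (t g : ℂ) • φ g
      map_one' := by simp [ht1]
      map_mul' := fun g h => by rw [map_mul, htmul, smul_mul_smul_comm]; push_cast; rfl }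
  have hψ : ∀ g, ψ g = (t g : ℂ) • φ g := fun _ => rfl
  obtain ⟨R, hR⟩ := unitarize ψ H (by
    intro h hh
    obtain ⟨c, hc⟩ := hH h hh
    refine ⟨t h * c, ?_, by rw [hψ, hc, smul_smul]⟩
    have h1 := htn h
    rw [hc, det_smul] at h1
    simp only [det_one, mul_one, Fintype.card_fin, norm_pow] at h1
    rw [← mul_pow] at h1
    rw [norm_mul, Complex.norm_real, Real.norm_of_nonneg (htpos h).le]
    exact (pow_eq_one_iff_of_nonneg (mul_nonneg (htpos h).le (norm_nonneg _)) hn.ne').mp h1)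
  let u : G →* unitary (EuclideanSpace ℂ (Fin n) →L[ℂ] EuclideanSpace ℂ (Fin n)) :=
    { toFun := fun g => ⟨toEuclideanCLM (𝕜 := ℂ) (n := Fin n) _, Unitary.map_mem (toEuclideanCLM (𝕜 := ℂ) (n := Fin n)) (hR g)⟩
      map_one' := by apply Subtype.ext; simp
      map_mul' := fun g h => by
        apply Subtype.ext
        simp only [Submonoid.coe_mul]
        rw [← map_mul]
        congr 1
        rw [map_mul]
        simp [mul_assoc] }
  have hu : ∀ g, (u g : EuclideanSpace ℂ (Fin n) →L[ℂ] EuclideanSpace ℂ (Fin n)) =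
    toEuclideanCLM (𝕜 := ℂ) (n := Fin n) ((R : Matrix (Fin n) (Fin n) ℂ) * ψ g * (R⁻¹ : (Matrix (Fin n) (Fin n) ℂ)ˣ)) := fun _ => rfl
  obtain ⟨K, hK0, hK, hc⟩ := hJ G u H (by
    intro h hh
    obtain ⟨c, hc⟩ := hH h hh
    refine ⟨t h * c, ?_⟩
    rw [hu, hψ, hc, smul_smul]
    simp)
  refine ⟨K, hK0, hK, fun x hx y hy => ?_⟩
  have h1 := congrArg Subtype.val (hc x hx y hy).eq
  rw [← map_mul, ← map_mul, hu, hu] at h1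
  have h2 := (toEuclideanCLM (𝕜 := ℂ) (n := Fin n)).injective h1
  rw [mul_assoc, mul_assoc, Units.mul_right_inj, Units.mul_left_inj, map_mul, map_mul, hψ, hψ,
    smul_mul_smul_comm, smul_mul_smul_comm, mul_comm (t y : ℂ)] at h2
  have h3 : (t x : ℂ) * t y ≠ 0 := by
    exact mul_ne_zero (by exact_mod_cast (htpos x).ne') (by exact_mod_cast (htpos y).ne')
  exact smul_right_injective _ h3 h2

end JordanMatrix


section Reps
open Module
open scoped commutatorElement

/-- derived series of a subgroup, inside the ambient group -/
def dser {G : Type*} [Group G] (K : Subgroup G) : ℕ → Subgroup G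
  | 0 => K
  | (n+1) => ⁅dser K n, dser K n⁆

lemma dser_mono {G : Type*} [Group G] {K K' : Subgroup G} (h : K ≤ K') (n : ℕ) :
    dser K n ≤ dser K' n := by
  induction n with
  | zero => exact h
  | succ n ih => exact Subgroup.commutator_mono ih ih

lemma dser_normal {G : Type*} [Group G] (K : Subgroup G) [K.Normal] (n : ℕ) : (dser K n).Normal := by
  induction n with
  | zero => assumption
  | succ n ih => exact Subgroup.commutator_normal _ _

lemma dser_succ_le {G : Type*} [Group G] (K : Subgroup G) (n : ℕ) : dser K (n+1) ≤ dser K n := by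
  show ⁅dser K n, dser K n⁆ ≤ _
  rw [Subgroup.commutator_le]
  intro a ha b hb
  rw [commutatorElement_def]
  exact mul_mem (mul_mem (mul_mem ha hb) (inv_mem ha)) (inv_mem hb)

lemma dser_anti {G : Type*} [Group G] (K : Subgroup G) : Antitone (dser K) :=
  antitone_nat_of_succ_le (dser_succ_le K)

lemma dser_map {G G' : Type*} [Group G] [Group G'] (f : G →* G') (K : Subgroup G) (n : ℕ) :
    (dser K n).map f = dser (K.map f) n := by
  induction n with
  | zero => rfl
  | succ n ih => simp only [dser]; rw [Subgroup.map_commutator, ih]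

variable {G : Type} [Group G] {V : Type} [AddCommGroup V] [Module ℂ V] [FiniteDimensional ℂ V]

def Good (ρ : G →* End ℂ V) (N L : ℕ) : Prop :=
  ∃ K : Subgroup G, K.index ≠ 0 ∧ K.index ≤ N ∧ ∀ g ∈ dser K L, ρ g = 1

def PVS (ρ : G →* End ℂ V) (H : Subgroup G) (l : ℕ) : Prop :=
  ∀ g ∈ dser H l, ∃ c : ℂ, ρ g = c • 1

lemma Good.mono {ρ : G →* End ℂ V} {N L N' L' : ℕ} (h : Good ρ N L) (hN : N ≤ N') (hL : L ≤ L') :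
    Good ρ N' L' := by
  obtain ⟨K, h1, h2, h3⟩ := h
  exact ⟨K, h1, h2.trans hN, fun g hg => h3 g (dser_anti K hL hg)⟩

lemma good_of_subgroup (ρ : G →* End ℂ V) (K1 : Subgroup G) {m N L : ℕ} (h0 : K1.index ≠ 0)
    (hm : K1.index ≤ m) (h : Good (ρ.comp K1.subtype) N L) : Good ρ (m * N) L := by
  obtain ⟨K, h1, h2, h3⟩ := h
  refine ⟨K.map K1.subtype, ?_, ?_, ?_⟩
  · rw [Subgroup.index_map_subtype]; exact mul_ne_zero h1 h0
  · rw [Subgroup.index_map_subtype, mul_comm]; exact Nat.mul_le_mul hm h2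
  · intro g hg
    rw [← dser_map] at hg
    obtain ⟨x, hx, rfl⟩ := hg
    exact h3 x hx

lemma PVS.subgroup {ρ : G →* End ℂ V} {H : Subgroup G} {l : ℕ} (h : PVS ρ H l) (K1 : Subgroup G) :
    PVS (ρ.comp K1.subtype) (H.subgroupOf K1) l := by
  intro g hg
  apply h
  have : K1.subtype g ∈ (dser (H.subgroupOf K1) l).map K1.subtype := Subgroup.mem_map_of_mem _ hg
  rw [dser_map] at this
  refine dser_mono ?_ _ this
  rw [Subgroup.map_le_iff_le_comap]
  exact le_rfl

def subRep (ρ : G →* End ℂ V) (U : Submodule ℂ V) (hU : ∀ g, ∀ v ∈ U, ρ g v ∈ U) : G →* End ℂ U where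
  toFun g := (ρ g).restrict (hU g)
  map_one' := by ext; simp
  map_mul' g h := by ext; simp

def quotRep (ρ : G →* End ℂ V) (U : Submodule ℂ V) (hU : ∀ g, ∀ v ∈ U, ρ g v ∈ U) :
    G →* End ℂ (V ⧸ U) where
  toFun g := U.mapQ U (ρ g) (hU g)
  map_one' := by ext; simp
  map_mul' g h := by ext; simp

lemma PVS.sub {ρ : G →* End ℂ V} {H : Subgroup G} {l : ℕ} (h : PVS ρ H l) (U : Submodule ℂ V)
    (hU : ∀ g, ∀ v ∈ U, ρ g v ∈ U) : PVS (subRep ρ U hU) H l := by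
  intro g hg
  obtain ⟨c, hc⟩ := h g hg
  refine ⟨c, ?_⟩
  ext v
  simp [subRep, hc]

lemma PVS.quot {ρ : G →* End ℂ V} {H : Subgroup G} {l : ℕ} (h : PVS ρ H l) (U : Submodule ℂ V)
    (hU : ∀ g, ∀ v ∈ U, ρ g v ∈ U) : PVS (quotRep ρ U hU) H l := by
  intro g hg
  obtain ⟨c, hc⟩ := h g hg
  refine ⟨c, ?_⟩
  ext v
  simp [quotRep, hc]

lemma commutator_one_of_commute (ρ : G →* End ℂ V) (x y : G) (h : Commute (ρ x) (ρ y)) :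
    ρ ⁅x, y⁆ = 1 := by
  rw [commutatorElement_def, map_mul, map_mul, map_mul, h.eq]
  have : ρ y * ρ x * ρ x⁻¹ * ρ y⁻¹ = ρ (y * x * x⁻¹ * y⁻¹) := by simp only [map_mul]
  rw [this]; simp

lemma dser_succ_trivial (ρ : G →* End ℂ V) (K : Subgroup G) (L : ℕ)
    (h : ∀ x ∈ dser K L, ∀ y ∈ dser K L, Commute (ρ x) (ρ y)) : ∀ g ∈ dser K (L+1), ρ g = 1 := by
  intro g hg
  have : dser K (L+1) ≤ ρ.ker := by
    show ⁅dser K L, dser K L⁆ ≤ _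
    rw [Subgroup.commutator_le]
    intro a ha b hb
    rw [MonoidHom.mem_ker]
    exact commutator_one_of_commute ρ a b (h a ha b hb)
  exact MonoidHom.mem_ker.mp (this hg)

lemma good_reduce (ρ : G →* End ℂ V) (U : Submodule ℂ V) (hU : ∀ g, ∀ v ∈ U, ρ g v ∈ U) {N L : ℕ}
    (h1 : Good (subRep ρ U hU) N L) (h2 : Good (quotRep ρ U hU) N L) : Good ρ (N * N) (L+1) := by
  obtain ⟨K, a1, a2, a3⟩ := h1
  obtain ⟨K', b1, b2, b3⟩ := h2
  refine ⟨K ⊓ K', Subgroup.index_inf_ne_zero a1 b1, Subgroup.index_inf_le.trans (Nat.mul_le_mul a2 b2), ?_⟩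
  apply dser_succ_trivial
  have hx : ∀ x ∈ dser (K ⊓ K') L, (∀ v ∈ U, ρ x v = v) ∧ (∀ v, ρ x v - v ∈ U) := by
    intro x hx
    constructor
    · intro v hv
      have := a3 x (dser_mono inf_le_left _ hx)
      have := congrArg (fun T : End ℂ U => ((T ⟨v, hv⟩ : U) : V)) this
      simpa [subRep] using this
    · intro v
      have := b3 x (dser_mono inf_le_right _ hx)
      have := congrArg (fun T : End ℂ (V ⧸ U) => T (Submodule.Quotient.mk v)) this
      rw [← Submodule.Quotient.eq]
      simpa [quotRep] using this
  have key : ∀ x ∈ dser (K ⊓ K') L, ∀ y ∈ dser (K ⊓ K') L, ∀ v, ρ x (ρ y v) = ρ x v + ρ y v - v := by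
    intro x hx' y hy' v
    have e1 := (hx x hx').1 _ ((hx y hy').2 v)
    rw [map_sub] at e1
    rw [sub_eq_iff_eq_add] at e1
    rw [e1]; abel
  intro x hx' y hy'
  apply LinearMap.ext
  intro v
  show ρ x (ρ y v) = ρ y (ρ x v)
  rw [key x hx' y hy', key y hy' x hx']
  abel

lemma rep_inv_left (ρ : G →* End ℂ V) (g : G) (v : V) : ρ g⁻¹ (ρ g v) = v := by
  have : (ρ g⁻¹ * ρ g) v = v := by rw [← map_mul]; simp
  exact this

lemma rep_inv_right (ρ : G →* End ℂ V) (g : G) (v : V) : ρ g (ρ g⁻¹ v) = v := by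
  have : (ρ g * ρ g⁻¹) v = v := by rw [← map_mul]; simp
  exact this

def stabSub (ρ : G →* End ℂ V) (U : Submodule ℂ V) : Subgroup G where
  carrier := {g | U.map (ρ g) = U}
  one_mem' := by
    show U.map (ρ 1) = U
    rw [map_one]; exact Submodule.map_id U
  mul_mem' := by
    intro a b (ha : U.map (ρ a) = U) (hb : U.map (ρ b) = U)
    show U.map (ρ (a * b)) = U
    rw [map_mul, Module.End.mul_eq_comp, Submodule.map_comp, hb, ha]
  inv_mem' := by
    intro a (ha : U.map (ρ a) = U)
    show U.map (ρ a⁻¹) = U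
    conv_lhs => rw [← ha]
    rw [← Submodule.map_comp, ← Module.End.mul_eq_comp, ← map_mul, inv_mul_cancel, map_one]
    exact Submodule.map_id U

lemma mem_stabSub {ρ : G →* End ℂ V} {U : Submodule ℂ V} {g : G} :
    g ∈ stabSub ρ U ↔ U.map (ρ g) = U := Iff.rfl

lemma stab_index (ρ : G →* End ℂ V) (U : Submodule ℂ V) (hU : U ≠ ⊥) {ι : Type*}
    (p : ι → Submodule ℂ V) (hp : iSupIndep p) (h : ∀ g, ∃ i, U.map (ρ g) = p i) :
    (stabSub ρ U).index ≠ 0 ∧ (stabSub ρ U).index ≤ finrank ℂ V := by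
  choose f hf using h
  have hfin : Finite {i // p i ≠ ⊥} := WellFoundedGT.finite_ne_bot_of_iSupIndep hp
  have : Fintype {i // p i ≠ ⊥} := Fintype.ofFinite _
  have hne : ∀ g, p (f g) ≠ ⊥ := by
    intro g h0
    rw [← hf] at h0
    apply hU
    rw [eq_bot_iff]
    intro v hv
    have : ρ g v ∈ U.map (ρ g) := Submodule.mem_map_of_mem hv
    rw [h0, Submodule.mem_bot] at this
    rw [Submodule.mem_bot, ← rep_inv_left ρ g v, this, map_zero]
  obtain ⟨h1, h2⟩ := index_le_of_color (stabSub ρ U) (fun g => (⟨f g, hne g⟩ : {i // p i ≠ ⊥})) (by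
    intro g h hgh
    have e : f g = f h := congrArg Subtype.val hgh
    rw [mem_stabSub, map_mul, Module.End.mul_eq_comp, Submodule.map_comp, hf h, ← e, ← hf g,
      ← Submodule.map_comp, ← Module.End.mul_eq_comp, ← map_mul, inv_mul_cancel, map_one]
    exact Submodule.map_id U)
  refine ⟨h1, h2.trans ?_⟩
  rw [Nat.card_eq_fintype_card]
  exact hp.subtype_ne_bot_le_finrank

def Claim (n N L : ℕ) : Prop :=
  ∀ (G : Type) [Group G] (V : Type) [AddCommGroup V] [Module ℂ V] [FiniteDimensional ℂ V]
    (ρ : G →* End ℂ V) (H : Subgroup G) (l : ℕ), H.FiniteIndex → finrank ℂ V ≤ n → PVS ρ H l → Good ρ N L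

lemma reduce_main {n N L : ℕ} (hC : Claim n N L) (ρ : G →* End ℂ V) (hV : finrank ℂ V = n + 1)
    (H : Subgroup G) [H.FiniteIndex] (l : ℕ) (hH : PVS ρ H l) (K0 : Subgroup G) (m : ℕ)
    (hK0 : K0.index ≠ 0) (hm : K0.index ≤ m)
    (U : Submodule ℂ V) (hU : U ≠ ⊥) (hU' : U ≠ ⊤) {ι : Type*}
    (p : ι → Submodule ℂ V) (hp : iSupIndep p) (h : ∀ g ∈ K0, ∃ i, U.map (ρ g) = p i) :
    Good ρ (m * ((n+1) * (N * N))) (L+1) := by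
  apply good_of_subgroup ρ K0 hK0 hm
  set ρ0 := ρ.comp K0.subtype with hρ0
  obtain ⟨s1, s2⟩ := stab_index ρ0 U hU p hp (fun g => h g g.2)
  rw [hV] at s2
  apply good_of_subgroup ρ0 (stabSub ρ0 U) s1 s2
  have hinv : ∀ g, ∀ v ∈ U, (ρ0.comp (stabSub ρ0 U).subtype) g v ∈ U := by
    intro g v hv
    have := mem_stabSub.mp g.2
    have h2 : ρ0 g v ∈ U.map (ρ0 g) := Submodule.mem_map_of_mem hv
    rw [this] at h2
    exact h2
  apply good_reduce _ U hinv
  · refine hC _ _ _ _ l inferInstance ?_ (((hH.subgroup K0).subgroup (stabSub ρ0 U)).sub U hinv)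
    have := Submodule.finrank_lt hU'
    omega
  · refine hC _ _ _ _ l inferInstance ?_ (((hH.subgroup K0).subgroup (stabSub ρ0 U)).quot U hinv)
    have h1 := Submodule.finrank_quotient_add_finrank U
    have h2 : 0 < finrank ℂ U := by
      rw [Module.finrank_pos_iff, Submodule.nontrivial_iff_ne_bot]; exact hU
    omega

end Reps


section Weights
open Module
open scoped commutatorElement

variable {G : Type} [Group G] {V : Type} [AddCommGroup V] [Module ℂ V] [FiniteDimensional ℂ V]

lemma common_eigen {ι : Type*} (f : ι → End ℂ V) (hf : ∀ i j, Commute (f i) (f j)) [Nontrivial V] :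
    ∃ v : V, v ≠ 0 ∧ ∀ i, ∃ c : ℂ, f i v = c • v := by
  obtain ⟨W, ⟨hW0, hWinv⟩, hmin⟩ := WellFounded.has_min (wellFounded_lt (α := Submodule ℂ V))
    {W : Submodule ℂ V | W ≠ ⊥ ∧ ∀ i, ∀ v ∈ W, f i v ∈ W} ⟨⊤, top_ne_bot, fun _ _ _ => trivial⟩
  have : Nontrivial W := (Submodule.nontrivial_iff_ne_bot).mpr hW0
  obtain ⟨w, hw⟩ := exists_ne (0 : W)
  refine ⟨w, by simpa using hw, fun i => ?_⟩
  obtain ⟨μ, hμ⟩ := Module.End.exists_eigenvalue ((f i).restrict (hWinv i))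
  obtain ⟨v, hv⟩ := hμ.exists_hasEigenvector
  have hv1 : f i v = μ • (v : V) := congrArg Subtype.val hv.apply_eq_smul
  set W' := W ⊓ Module.End.eigenspace (f i) μ with hW'
  have hle : W' ≤ W := inf_le_left
  suffices hnlt : ¬ W' < W by
    have heq : W' = W := eq_of_le_of_not_lt hle hnlt
    have : (w : V) ∈ W' := by rw [heq]; exact w.2
    exact ⟨μ, Module.End.mem_eigenspace_iff.mp this.2⟩
  refine hmin W' ⟨?_, ?_⟩
  · intro h0
    have : (v : V) ∈ W' := ⟨v.2, Module.End.mem_eigenspace_iff.mpr hv1⟩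
    rw [h0, Submodule.mem_bot] at this
    exact hv.2 (by simpa using this)
  · intro j x hx
    refine ⟨hWinv j x hx.1, ?_⟩
    have hx2 := Module.End.mem_eigenspace_iff.mp hx.2
    refine Module.End.mem_eigenspace_iff.mpr ?_
    have := congrArg (fun T : End ℂ V => T x) (hf i j).eq
    simp only [Module.End.mul_apply] at this
    rw [this, hx2, map_smul]

def wt (ρ : G →* End ℂ V) (B : Subgroup G) (χ : B → ℂ) : Submodule ℂ V :=
  ⨅ b : B, Module.End.eigenspace (ρ b) (χ b)

lemma mem_wt {ρ : G →* End ℂ V} {B : Subgroup G} {χ : B → ℂ} {v : V} :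
    v ∈ wt ρ B χ ↔ ∀ b : B, ρ b v = χ b • v := by
  simp [wt, Submodule.mem_iInf]

lemma wt_indep (ρ : G →* End ℂ V) (B : Subgroup G)
    (hc : ∀ a ∈ B, ∀ b ∈ B, Commute (ρ a) (ρ b)) : iSupIndep (wt ρ B) := by
  have := Module.End.independent_iInf_maxGenEigenspace_of_forall_mapsTo (fun b : B => ρ b)
    (fun i j φ => Module.End.mapsTo_maxGenEigenspace_of_comm (hc j j.2 i i.2) φ)
  refine this.mono ?_
  intro χ
  refine iInf_mono fun b => ?_
  exact (Module.End.genEigenspace _ _).mono le_top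

lemma wt_map (ρ : G →* End ℂ V) (B : Subgroup G) [hB : B.Normal] (χ : B → ℂ) (g : G) :
    (wt ρ B χ).map (ρ g) =
      wt ρ B (fun b => χ ⟨g⁻¹ * b * g, by simpa using hB.conj_mem b b.2 g⁻¹⟩) := by
  apply le_antisymm
  · rintro _ ⟨v, hv, rfl⟩
    have hv := mem_wt.mp hv
    rw [mem_wt]
    intro b
    have h1 := hv ⟨g⁻¹ * b * g, by simpa using hB.conj_mem b b.2 g⁻¹⟩
    have h2 : ρ b (ρ g v) = ρ g (ρ (g⁻¹ * b * g) v) := by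
      rw [← Module.End.mul_apply, ← Module.End.mul_apply, ← map_mul, ← map_mul]
      congr 2
      group
    rw [h2]
    simp only at h1
    rw [h1, map_smul]
  · intro w hw
    have hw := mem_wt.mp hw
    refine ⟨ρ g⁻¹ w, ?_, rep_inv_right ρ g w⟩
    rw [SetLike.mem_coe, mem_wt]
    intro b
    have h1 := hw ⟨g * b * g⁻¹, hB.conj_mem b b.2 g⟩
    have h2 : ρ b (ρ g⁻¹ w) = ρ g⁻¹ (ρ (g * b * g⁻¹) w) := by
      rw [← Module.End.mul_apply, ← Module.End.mul_apply, ← map_mul, ← map_mul]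
      congr 2
      group
    rw [h2]
    simp only at h1
    rw [h1, map_smul]
    congr 2
    apply Subtype.ext
    simp only
    group

def conjRep (ρ : G →* End ℂ V) : G →* End ℂ (End ℂ V) where
  toFun g := (LinearMap.mulLeft ℂ (ρ g)).comp (LinearMap.mulRight ℂ (ρ g⁻¹))
  map_one' := by ext; simp
  map_mul' g h := by
    apply LinearMap.ext; intro T
    simp [mul_assoc]

lemma conjRep_apply (ρ : G →* End ℂ V) (g : G) (T : End ℂ V) : conjRep ρ g T = ρ g * T * ρ g⁻¹ := by
  simp [conjRep, mul_assoc]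

lemma conjRep_scalar (ρ : G →* End ℂ V) (g : G) (c : ℂ) (h : ρ g = c • 1) : conjRep ρ g = 1 := by
  apply LinearMap.ext; intro T
  rw [conjRep_apply]
  have : ρ g * T = T * ρ g := by rw [h]; simp
  rw [this, mul_assoc, ← map_mul]; simp

lemma conjRep_rep (ρ : G →* End ℂ V) (g b : G) : conjRep ρ g (ρ b) = ρ (g * b * g⁻¹) := by
  rw [conjRep_apply, map_mul, map_mul]

def centr (ρ : G →* End ℂ V) (B : Subgroup G) : Subgroup G where
  carrier := {z | z ∈ B ∧ ∀ b ∈ B, ρ (b * z * b⁻¹) = ρ z}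
  one_mem' := ⟨B.one_mem, by simp⟩
  mul_mem' := by
    rintro x y ⟨hx, hx'⟩ ⟨hy, hy'⟩
    refine ⟨B.mul_mem hx hy, fun b hb => ?_⟩
    rw [map_mul ρ x y, ← hx' b hb, ← hy' b hb, ← map_mul]
    congr 1; group
  inv_mem' := by
    rintro x ⟨hx, hx'⟩
    refine ⟨B.inv_mem hx, fun b hb => ?_⟩
    have e := hx' b hb
    have : ρ (b * x⁻¹ * b⁻¹) * ρ (b * x * b⁻¹) * ρ x⁻¹ = ρ (b * x⁻¹ * b⁻¹) * ρ x * ρ x⁻¹ := by rw [e]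
    simp only [← map_mul] at this
    convert this.symm using 2 <;> group

lemma mem_centr {ρ : G →* End ℂ V} {B : Subgroup G} {z : G} :
   z ∈ centr ρ B ↔ z ∈ B ∧ ∀ b ∈ B, ρ (b * z * b⁻¹) = ρ z := Iff.rfl

lemma commute_of_conj (ρ : G →* End ℂ V) (b z : G) (h : ρ (b * z * b⁻¹) = ρ z) : Commute (ρ b) (ρ z) := by
  show ρ b * ρ z = ρ z * ρ b
  conv_rhs => rw [← h]
  rw [← map_mul, ← map_mul]; congr 1; group

instance centr_normal (ρ : G →* End ℂ V) (B : Subgroup G) [hB : B.Normal] : (centr ρ B).Normal where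
  conj_mem := by
    rintro z ⟨hz, hz'⟩ g
    refine ⟨hB.conj_mem z hz g, fun b hb => ?_⟩
    have h1 := hz' (g⁻¹ * b * g) (by simpa using hB.conj_mem b hb g⁻¹)
    have h2 : b * (g * z * g⁻¹) * b⁻¹ = g * ((g⁻¹ * b * g) * z * (g⁻¹ * b * g)⁻¹) * g⁻¹ := by group
    rw [h2, map_mul, map_mul, h1, ← map_mul, ← map_mul]

lemma case_centr {n N L : ℕ} (hC : Claim n N L) (ρ : G →* End ℂ V) (hV : finrank ℂ V = n + 1)
    (H : Subgroup G) [H.FiniteIndex] (l : ℕ) (hH : PVS ρ H l) (B : Subgroup G) [B.Normal]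
    (z : G) (hz : z ∈ centr ρ B) (hzs : ∀ c : ℂ, ρ z ≠ c • 1) :
    Good ρ (1 * ((n+1) * (N * N))) (L+1) := by
  have : Nontrivial V := Module.nontrivial_of_finrank_pos (R := ℂ) (by omega)
  have hcomm : ∀ a ∈ centr ρ B, ∀ b ∈ centr ρ B, Commute (ρ a) (ρ b) :=
    fun a ha b hb => commute_of_conj ρ a b (hb.2 a ha.1)
  obtain ⟨v, hv0, hv⟩ := common_eigen (fun a : centr ρ B => ρ a) (fun a b => hcomm a a.2 b b.2)
  choose χ hχ using hv
  refine reduce_main hC ρ hV H l hH ⊤ 1 (by simp) (by simp) (wt ρ (centr ρ B) χ) ?_ ?_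
    (wt ρ (centr ρ B)) (wt_indep ρ _ hcomm) (fun g _ => ⟨_, wt_map ρ _ χ g⟩)
  · intro h0
    have : v ∈ wt ρ (centr ρ B) χ := mem_wt.mpr hχ
    rw [h0] at this
    exact hv0 (by simpa using this)
  · intro h0
    apply hzs (χ ⟨z, hz⟩)
    apply LinearMap.ext
    intro w
    have : w ∈ wt ρ (centr ρ B) χ := h0 ▸ Submodule.mem_top
    exact mem_wt.mp this ⟨z, hz⟩

lemma case_conj {n N L : ℕ} (hC : Claim n N L) (ρ : G →* End ℂ V) (hV : finrank ℂ V = n + 1)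
    (H : Subgroup G) [H.FiniteIndex] (l : ℕ) (hH : PVS ρ H l) (B : Subgroup G) [hB : B.Normal]
    (hBB : ∀ a ∈ B, ∀ b ∈ B, ∃ c : ℂ, ρ ⁅a, b⁆ = c • 1)
    (hZ : ∀ z ∈ centr ρ B, ∃ c : ℂ, ρ z = c • 1)
    (b₀ : G) (hb₀ : b₀ ∈ B) (hbs : ∀ c : ℂ, ρ b₀ ≠ c • 1) :
    Good ρ ((n+1)^2 * ((n+1) * (N * N))) (L+1) := by
  have : Nontrivial V := Module.nontrivial_of_finrank_pos (R := ℂ) (by omega)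
  have hone : (1 : End ℂ V) ≠ 0 := one_ne_zero
  have hρ0 : ∀ g, ρ g ≠ 0 := by
    intro g h0
    have : ρ g * ρ g⁻¹ = 1 := by rw [← map_mul]; simp
    rw [h0, zero_mul] at this
    exact hone this.symm
  set σ := conjRep ρ with hσ
  have hcomm : ∀ a ∈ B, ∀ b ∈ B, Commute (σ a) (σ b) := by
    intro a ha b hb
    obtain ⟨c, hc⟩ := hBB a ha b hb
    have h1 := conjRep_scalar ρ _ c hc
    show σ a * σ b = σ b * σ a
    rw [← map_mul, ← map_mul]
    have : a * b = ⁅a, b⁆ * (b * a) := by rw [commutatorElement_def]; group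
    rw [this, map_mul, hσ, h1, one_mul]
  have hχ : ∀ b : B, ∃ c : ℂ, σ b (ρ b₀) = c • ρ b₀ := by
    intro b
    obtain ⟨c, hc⟩ := hBB b b.2 b₀ hb₀
    refine ⟨c, ?_⟩
    rw [hσ, conjRep_rep]
    have : (b : G) * b₀ * (b : G)⁻¹ = ⁅(b : G), b₀⁆ * b₀ := by rw [commutatorElement_def]; group
    rw [this, map_mul, hc]; simp
  choose χ hχ using hχ
  have hmem : ρ b₀ ∈ wt σ B χ := mem_wt.mpr hχ
  obtain ⟨s1, s2⟩ := stab_index σ (wt σ B χ) (by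
    intro h0
    rw [h0] at hmem
    exact hρ0 b₀ (by simpa using hmem)) (wt σ B) (wt_indep σ B hcomm) (fun g => ⟨_, wt_map σ B χ g⟩)
  have hfr : finrank ℂ (End ℂ V) = (n+1)^2 := by
    rw [Module.finrank_linearMap, hV]; ring
  rw [hfr] at s2
  -- stabilizer elements scale b₀
  have hscale : ∀ c ∈ stabSub σ (wt σ B χ), ∃ ζ : ℂ, ρ (c * b₀ * c⁻¹) = ζ • ρ b₀ := by
    intro c hc
    have h1 : ρ (c * b₀ * c⁻¹) ∈ wt σ B χ := by
      have : σ c (ρ b₀) ∈ (wt σ B χ).map (σ c) := Submodule.mem_map_of_mem hmem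
      rw [mem_stabSub.mp hc, hσ, conjRep_rep] at this
      exact this
    have h2 := mem_wt.mp h1
    obtain ⟨ζ, hζ⟩ := hZ (b₀⁻¹ * (c * b₀ * c⁻¹)) (by
      refine ⟨B.mul_mem (B.inv_mem hb₀) (hB.conj_mem _ hb₀ _), fun b hb => ?_⟩
      have h3 := h2 ⟨b, hb⟩
      have h4 := hχ ⟨b, hb⟩
      rw [hσ, conjRep_rep] at h3 h4
      simp only at h3 h4
      -- ρ(b b₀⁻¹ b⁻¹) * (χ • ρ b₀) = 1
      have h5 : ρ (b * b₀⁻¹ * b⁻¹) * (χ ⟨b, hb⟩ • ρ b₀) = 1 := by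
        rw [← h4, ← map_mul]
        have : b * b₀⁻¹ * b⁻¹ * (b * b₀ * b⁻¹) = 1 := by group
        rw [this, map_one]
      calc ρ (b * (b₀⁻¹ * (c * b₀ * c⁻¹)) * b⁻¹)
          = ρ (b * b₀⁻¹ * b⁻¹) * ρ (b * (c * b₀ * c⁻¹) * b⁻¹) := by
            rw [← map_mul]; congr 1; group
        _ = ρ (b * b₀⁻¹ * b⁻¹) * (χ ⟨b, hb⟩ • ρ (b₀ * (b₀⁻¹ * (c * b₀ * c⁻¹)))) := by
            rw [h3]; congr 3; group
        _ = (ρ (b * b₀⁻¹ * b⁻¹) * (χ ⟨b, hb⟩ • ρ b₀)) * ρ (b₀⁻¹ * (c * b₀ * c⁻¹)) := by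
            rw [map_mul ρ b₀, ← smul_mul_assoc, ← mul_assoc]
        _ = _ := by rw [h5, one_mul])
    refine ⟨ζ, ?_⟩
    have : c * b₀ * c⁻¹ = b₀ * (b₀⁻¹ * (c * b₀ * c⁻¹)) := by group
    rw [this, map_mul, hζ]; simp
  obtain ⟨lam, hlam⟩ := Module.End.exists_eigenvalue (ρ b₀)
  refine reduce_main hC ρ hV H l hH _ _ s1 s2 (Module.End.eigenspace (ρ b₀) lam) hlam ?_
    (Module.End.eigenspace (ρ b₀)) (Module.End.eigenspaces_iSupIndep _) ?_
  · intro h0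
    apply hbs lam
    apply LinearMap.ext
    intro w
    have : w ∈ Module.End.eigenspace (ρ b₀) lam := h0 ▸ Submodule.mem_top
    exact Module.End.mem_eigenspace_iff.mp this
  · intro c hc
    obtain ⟨ζ, hζ⟩ := hscale c hc
    have hζ0 : ζ ≠ 0 := by
      rintro rfl
      rw [zero_smul] at hζ
      exact hρ0 _ hζ
    have hconj : ∀ v, ρ c (ρ b₀ (ρ c⁻¹ v)) = ζ • ρ b₀ v := by
      intro v
      have := congrArg (fun T : End ℂ V => T v) hζ
      simpa [map_mul] using this
    refine ⟨ζ⁻¹ * lam, ?_⟩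
    apply le_antisymm
    · rintro _ ⟨v, hv, rfl⟩
      have hv := Module.End.mem_eigenspace_iff.mp hv
      rw [Module.End.mem_eigenspace_iff]
      have := hconj (ρ c v)
      rw [rep_inv_left, hv, map_smul] at this
      rw [mul_smul, this, smul_smul, inv_mul_cancel₀ hζ0, one_smul]
    · intro w hw
      have hw := Module.End.mem_eigenspace_iff.mp hw
      refine ⟨ρ c⁻¹ w, ?_, rep_inv_right ρ c w⟩
      rw [SetLike.mem_coe, Module.End.mem_eigenspace_iff]
      have := hconj w
      rw [hw, smul_smul, ← mul_assoc, mul_inv_cancel₀ hζ0, one_mul] at this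
      have h2 := congrArg (ρ c⁻¹) this
      rwa [rep_inv_left, map_smul] at h2

lemma jordan_rep (n : ℕ) : ∃ J : ℕ, ∀ (G : Type) [Group G] (V : Type) [AddCommGroup V] [Module ℂ V]
    [FiniteDimensional ℂ V] (ρ : G →* End ℂ V) (H : Subgroup G), H.FiniteIndex → finrank ℂ V = n →
    (∀ h ∈ H, ∃ c : ℂ, ρ h = c • 1) → Good ρ J 1 := by
  obtain ⟨J, hJ⟩ := jordan_matrix n
  refine ⟨J, fun G _ V _ _ _ ρ H hfi hV hH => ?_⟩
  let e := LinearMap.toMatrixAlgEquiv (Module.finBasisOfFinrankEq ℂ V hV)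
  obtain ⟨K, h1, h2, h3⟩ := hJ G ((e : End ℂ V →* Matrix (Fin n) (Fin n) ℂ).comp ρ) H (by
    intro h hh
    obtain ⟨c, hc⟩ := hH h hh
    refine ⟨c, ?_⟩
    simp [hc])
  refine ⟨K, h1, h2, dser_succ_trivial ρ K 0 ?_⟩
  intro x hx y hy
  have := (h3 x hx y hy).eq
  apply e.injective
  simpa using this

lemma claim_succ {n N L : ℕ} (hC : Claim n N L) : ∃ N' L', Claim (n+1) N' L' := by
  obtain ⟨J, hJ⟩ := jordan_rep (n+1)
  refine ⟨N + J + (n+1)^2 * ((n+1) * (N * N)), L + 1, ?_⟩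
  intro G _ V _ _ _ ρ H l hfi hV hH
  rcases Nat.lt_or_ge n (finrank ℂ V) with hlt | hle
  swap
  · exact (hC G V ρ H l hfi hle hH).mono (by omega) (by omega)
  have hV : finrank ℂ V = n + 1 := by omega
  -- normalize
  have hH' : PVS ρ H.normalCore l := fun g hg => hH g (dser_mono (Subgroup.normalCore_le H) l hg)
  have hfi' : H.normalCore.FiniteIndex := inferInstance
  have hnorm : H.normalCore.Normal := inferInstance
  generalize H.normalCore = H₁ at hH' hfi' hnorm
  clear hH hfi H
  have hN1 : 1 * ((n+1) * (N * N)) ≤ (n+1)^2 * ((n+1) * (N * N)) :=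
    Nat.mul_le_mul_right _ (Nat.one_le_pow _ _ (by omega))
  induction l with
  | zero => exact (hJ G V ρ H₁ hfi' hV hH').mono (by omega) (by omega)
  | succ l ih =>
    by_cases hs : PVS ρ H₁ l
    · exact ih hs
    · unfold PVS at hs
      push Not at hs
      obtain ⟨b₀, hb₀, hbs⟩ := hs
      have hBn : (dser H₁ l).Normal := dser_normal H₁ l
      by_cases hZ : ∀ z ∈ centr ρ (dser H₁ l), ∃ c : ℂ, ρ z = c • 1
      · refine (case_conj hC ρ hV H₁ (l+1) hH' (dser H₁ l) ?_ hZ b₀ hb₀ hbs).mono (by omega) le_rfl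
        intro a ha b hb
        exact hH' _ (Subgroup.commutator_mem_commutator ha hb)
      · push Not at hZ
        obtain ⟨z, hz, hzs⟩ := hZ
        exact (case_centr hC ρ hV H₁ (l+1) hH' (dser H₁ l) z hz hzs).mono (by omega) le_rfl

theorem claim_all (n : ℕ) : ∃ N L, Claim n N L := by
  induction n with
  | zero =>
    refine ⟨1, 0, ?_⟩
    intro G _ V _ _ _ ρ H l hfi hV hH
    refine ⟨⊤, by simp, by simp, fun g _ => ?_⟩
    have : Subsingleton V := (Module.finrank_zero_iff (R := ℂ)).mp (by omega)
    exact Subsingleton.elim _ _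
  | succ n ih =>
    obtain ⟨N, L, h⟩ := ih
    exact claim_succ h

end Weights


section Final

variable {d k : ℕ}

/-- The point of affine space given by a tuple of invertible matrices. -/
def pt (a : Fin k → GL (Fin d) ℂ) : Fin k × Fin d × Fin d → ℂ :=
  fun x => (a x.1 : Matrix (Fin d) (Fin d) ℂ) x.2.1 x.2.2

/-- Zariski-closed sets of tuples. -/
def ZC (X : Set (Fin k → GL (Fin d) ℂ)) : Prop :=
  ∃ S : Set (MvPolynomial (Fin k × Fin d × Fin d) ℂ),
    ∀ a, a ∈ X ↔ ∀ P ∈ S, MvPolynomial.eval (pt a) P = 0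

lemma ZC.iInter {ι : Sort*} {X : ι → Set (Fin k → GL (Fin d) ℂ)} (h : ∀ i, ZC (X i)) :
    ZC (⋂ i, X i) := by
  choose S hS using h
  refine ⟨⋃ i, S i, fun a => ?_⟩
  simp only [Set.mem_iInter, hS, Set.mem_iUnion]
  constructor
  · rintro h P ⟨i, hi⟩
    exact h i P hi
  · intro h i P hP
    exact h P ⟨i, hP⟩

lemma ZC.union {X Y : Set (Fin k → GL (Fin d) ℂ)} (hX : ZC X) (hY : ZC Y) : ZC (X ∪ Y) := by
  obtain ⟨S, hS⟩ := hX
  obtain ⟨T, hT⟩ := hY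
  refine ⟨{R | ∃ P ∈ S, ∃ Q ∈ T, R = P * Q}, fun a => ?_⟩
  rw [Set.mem_union, hS, hT]
  constructor
  · rintro h R ⟨P, hP, Q, hQ, rfl⟩
    rw [map_mul]
    rcases h with h | h
    · rw [h P hP, zero_mul]
    · rw [h Q hQ, mul_zero]
  · intro h
    by_contra! hc
    obtain ⟨⟨P, hP, hP0⟩, Q, hQ, hQ0⟩ := hc
    have := h _ ⟨P, hP, Q, hQ, rfl⟩
    rw [map_mul] at this
    exact (mul_ne_zero hP0 hQ0) this

lemma ZC.empty : ZC (∅ : Set (Fin k → GL (Fin d) ℂ)) :=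
  ⟨{1}, fun a => by simp⟩

lemma ZC.iUnion {ι : Type*} [Finite ι] {X : ι → Set (Fin k → GL (Fin d) ℂ)}
    (h : ∀ i, ZC (X i)) : ZC (⋃ i, X i) := by
  classical
  have key : ∀ s : Set ι, s.Finite → ZC (⋃ i ∈ s, X i) := by
    intro s hs
    induction s, hs using Set.Finite.induction_on with
    | empty => simpa using ZC.empty
    | insert _ _ ih =>
      rw [Set.biUnion_insert]
      exact (h _).union ih
  simpa using key Set.univ Set.finite_univ

lemma word_poly (w : FreeGroup (Fin k)) :
    ∃ (q : MvPolynomial (Fin k × Fin d × Fin d) ℂ)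
      (M : Matrix (Fin d) (Fin d) (MvPolynomial (Fin k × Fin d × Fin d) ℂ)),
      (∀ a : Fin k → GL (Fin d) ℂ, MvPolynomial.eval (pt a) q ≠ 0) ∧
      ∀ a : Fin k → GL (Fin d) ℂ, M.map (MvPolynomial.eval (pt a)) =
        MvPolynomial.eval (pt a) q • (FreeGroup.lift a w : Matrix (Fin d) (Fin d) ℂ) := by
  induction w using FreeGroup.induction_on with
  | C1 => exact ⟨1, 1, by simp, fun a => by simp [Matrix.map_one]⟩
  | of i =>
    refine ⟨1, Matrix.of fun r s => MvPolynomial.X (i, r, s), by simp, fun a => ?_⟩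
    ext r s
    simp [pt]
  | inv_of i _ =>
    let M : Matrix (Fin d) (Fin d) (MvPolynomial (Fin k × Fin d × Fin d) ℂ) :=
      Matrix.of fun r s => MvPolynomial.X (i, r, s)
    have hM : ∀ a : Fin k → GL (Fin d) ℂ,
        M.map (MvPolynomial.eval (pt a)) = (a i : Matrix (Fin d) (Fin d) ℂ) := by
      intro a
      ext r s
      simp [M, pt]
    have hdet : ∀ a : Fin k → GL (Fin d) ℂ,
        MvPolynomial.eval (pt a) M.det = (a i : Matrix (Fin d) (Fin d) ℂ).det := by
      intro a
      rw [← hM a, RingHom.map_det]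
      rfl
    have hu : ∀ a : Fin k → GL (Fin d) ℂ, (a i : Matrix (Fin d) (Fin d) ℂ).det ≠ 0 := by
      intro a
      exact ((Matrix.isUnit_iff_isUnit_det _).1 (a i).isUnit).ne_zero
    refine ⟨M.det, M.adjugate, fun a => ?_, fun a => ?_⟩
    · rw [hdet]
      exact hu a
    · have h1 : M.adjugate.map (MvPolynomial.eval (pt a)) =
          (a i : Matrix (Fin d) (Fin d) ℂ).adjugate := by
        rw [← hM a]
        exact RingHom.map_adjugate (MvPolynomial.eval (pt a)) M
      rw [h1, hdet, map_inv, FreeGroup.lift_apply_of, Matrix.coe_units_inv, Matrix.inv_def,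
        smul_smul, Ring.mul_inverse_cancel _ (hu a).isUnit, one_smul]
  | mul x y hx hy =>
    obtain ⟨q, M, hq, hM⟩ := hx
    obtain ⟨q', M', hq', hM'⟩ := hy
    refine ⟨q * q', M * M', fun a => ?_, fun a => ?_⟩
    · rw [map_mul]
      exact mul_ne_zero (hq a) (hq' a)
    · rw [Matrix.map_mul, hM, hM', map_mul, map_mul, Units.val_mul, smul_mul_smul_comm]

lemma zc_word (w : FreeGroup (Fin k)) : ZC {a : Fin k → GL (Fin d) ℂ | FreeGroup.lift a w = 1} := by
  obtain ⟨q, M, hq, hM⟩ := word_poly (d := d) w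
  refine ⟨{P | ∃ i j, P = M i j - q * MvPolynomial.C ((1 : Matrix (Fin d) (Fin d) ℂ) i j)},
    fun a => ?_⟩
  have h2 : ∀ i j, MvPolynomial.eval (pt a) (M i j) = MvPolynomial.eval (pt a) q *
      (FreeGroup.lift a w : Matrix (Fin d) (Fin d) ℂ) i j := by
    intro i j
    have := congrFun (congrFun (hM a) i) j
    simpa using this
  simp only [Set.mem_ofPred_eq]
  constructor
  · rintro h P ⟨i, j, rfl⟩
    rw [map_sub, map_mul, h2, h, MvPolynomial.eval_C]
    simp
  · intro h
    ext i j
    have := h _ ⟨i, j, rfl⟩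
    rw [map_sub, map_mul, h2, MvPolynomial.eval_C, ← mul_sub] at this
    have h3 := (mul_eq_zero.1 this).resolve_left (hq a)
    rw [sub_eq_zero.1 h3]
    rfl

/-- The index type for subgroups of bounded index of a free group. -/
abbrev SubIdx (k N : ℕ) : Type := Σ n : Fin (N + 1), (Fin k → Equiv.Perm (Fin n)) × Fin n

/-- The subgroup of the free group associated with permutation data. -/
def subOf {k N : ℕ} (ι : SubIdx k N) : Subgroup (FreeGroup (Fin k)) :=
  (MulAction.stabilizer (Equiv.Perm (Fin ι.1)) ι.2.2).comap (FreeGroup.lift ι.2.1)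

lemma subOf_finiteIndex {k N : ℕ} (ι : SubIdx k N) : (subOf ι).FiniteIndex := by
  refine ⟨?_⟩
  unfold subOf
  rw [Subgroup.index_comap]
  exact Subgroup.FiniteIndex.index_ne_zero

lemma exists_subOf {k N : ℕ} (K : Subgroup (FreeGroup (Fin k))) (h0 : K.index ≠ 0)
    (hN : K.index ≤ N) : ∃ ι : SubIdx k N, subOf ι = K := by
  have hfin : K.FiniteIndex := ⟨h0⟩
  have hF : Finite (FreeGroup (Fin k) ⧸ K) := inferInstance
  have e : (FreeGroup (Fin k) ⧸ K) ≃ Fin K.index := Finite.equivFinOfCardEq rfl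
  let θ : FreeGroup (Fin k) →* Equiv.Perm (Fin K.index) :=
    (e.permCongrHom.toMonoidHom).comp (MulAction.toPermHom _ (FreeGroup (Fin k) ⧸ K))
  refine ⟨⟨⟨K.index, Nat.lt_succ_of_le hN⟩, fun i => θ (FreeGroup.of i),
    e ((1 : FreeGroup (Fin k)) : FreeGroup (Fin k) ⧸ K)⟩, ?_⟩
  have hθ : FreeGroup.lift (fun i => θ (FreeGroup.of i)) = θ := by
    ext1 i
    simp
  ext w
  unfold subOf
  rw [Subgroup.mem_comap]
  simp only []
  rw [hθ, MulAction.mem_stabilizer_iff]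
  have : (θ w) • e ((1 : FreeGroup (Fin k)) : FreeGroup (Fin k) ⧸ K) =
      e ((w : FreeGroup (Fin k)) : FreeGroup (Fin k) ⧸ K) := by
    simp [θ, Equiv.permCongrHom, Equiv.Perm.smul_def]
  rw [this, e.apply_eq_iff_eq, eq_comm, QuotientGroup.eq]
  simp

lemma dser_top {G : Type*} [Group G] (n : ℕ) : dser (⊤ : Subgroup G) n = derivedSeries G n := by
  induction n with
  | zero => rfl
  | succ n ih =>
    rw [derivedSeries_succ, ← ih]
    rfl

lemma solvable_iff_dser {G : Type*} [Group G] (H : Subgroup G) :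
    IsSolvable H ↔ ∃ l, dser H l = ⊥ := by
  have key : ∀ l, dser H l = (derivedSeries H l).map H.subtype := by
    intro l
    rw [← dser_top, dser_map, ← MonoidHom.range_eq_map, Subgroup.range_subtype]
  refine (Group.isSolvable_def H).trans (exists_congr fun l => ?_)
  rw [key, Subgroup.map_eq_bot_iff_of_injective _ H.subtype_injective]

lemma main_iff (d k N L : ℕ) (hcl : Claim d N L) (a : Fin k → GL (Fin d) ℂ) :
    (∃ H : Subgroup ↥(Subgroup.closure (Set.range a)), H.FiniteIndex ∧ IsSolvable ↥H) ↔
      ∃ ι : SubIdx k N, ∀ w ∈ dser (subOf ι) L, FreeGroup.lift a w = 1 := by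
  have hr : ∀ w, FreeGroup.lift a w ∈ Subgroup.closure (Set.range a) := by
    intro w
    rw [← FreeGroup.range_lift_eq_closure]
    exact ⟨w, rfl⟩
  let ψ : FreeGroup (Fin k) →* Subgroup.closure (Set.range a) :=
    (FreeGroup.lift a).codRestrict _ hr
  have hψ : ∀ w, ((ψ w : Subgroup.closure (Set.range a)) : GL (Fin d) ℂ) = FreeGroup.lift a w :=
    fun w => rfl
  have hsurj : Function.Surjective ψ := by
    rintro ⟨g, hg⟩
    rw [← FreeGroup.range_lift_eq_closure] at hg
    obtain ⟨w, hw⟩ := hg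
    exact ⟨w, Subtype.ext hw⟩
  constructor
  · rintro ⟨H, hfi, hsol⟩
    obtain ⟨l, hl⟩ := (solvable_iff_dser H).1 hsol
    let ρ : FreeGroup (Fin k) →* Module.End ℂ (Fin d → ℂ) :=
      ((Matrix.toLinAlgEquiv' : Matrix (Fin d) (Fin d) ℂ ≃ₐ[ℂ] _) :
        Matrix (Fin d) (Fin d) ℂ →* Module.End ℂ (Fin d → ℂ)).comp
        ((Units.coeHom _).comp (FreeGroup.lift a))
    have hρ : ∀ w, ρ w = 1 ↔ FreeGroup.lift a w = 1 := by
      intro w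
      have : ρ w = Matrix.toLinAlgEquiv' (FreeGroup.lift a w : Matrix (Fin d) (Fin d) ℂ) := rfl
      rw [this, EmbeddingLike.map_eq_one_iff, Units.val_eq_one]
    have hP : PVS ρ (H.comap ψ) l := by
      intro g hg
      refine ⟨1, ?_⟩
      rw [one_smul, hρ]
      have h1 : ψ g ∈ dser H l := by
        have : ψ g ∈ (dser (H.comap ψ) l).map ψ := ⟨g, hg, rfl⟩
        rw [dser_map] at this
        exact dser_mono (Subgroup.map_comap_le _ _) l this
      rw [hl, Subgroup.mem_bot] at h1
      rw [← hψ, h1]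
      rfl
    obtain ⟨K, hK0, hKN, hK⟩ := hcl (FreeGroup (Fin k)) (Fin d → ℂ) ρ (H.comap ψ) l
      ⟨by rw [Subgroup.index_comap_of_surjective _ hsurj]; exact hfi.index_ne_zero⟩ (by simp) hP
    obtain ⟨ι, rfl⟩ := exists_subOf K hK0 hKN
    exact ⟨ι, fun w hw => (hρ w).1 (hK w hw)⟩
  · rintro ⟨ι, hι⟩
    refine ⟨(subOf ι).map ψ, ⟨?_⟩, ?_⟩
    · have h1 := Subgroup.index_map_dvd (subOf ι) hsurj
      exact ne_zero_of_dvd_ne_zero (subOf_finiteIndex ι).index_ne_zero h1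
    · rw [solvable_iff_dser]
      refine ⟨L, ?_⟩
      rw [← dser_map, eq_bot_iff]
      rintro _ ⟨w, hw, rfl⟩
      rw [Subgroup.mem_bot]
      exact Subtype.ext (hι w hw)

lemma zc_main (d k : ℕ) :
    ZC {a : Fin k → GL (Fin d) ℂ | ∃ H : Subgroup ↥(Subgroup.closure (Set.range a)),
      H.FiniteIndex ∧ IsSolvable ↥H} := by
  obtain ⟨N, L, hcl⟩ := claim_all d
  have : {a : Fin k → GL (Fin d) ℂ | ∃ H : Subgroup ↥(Subgroup.closure (Set.range a)),
      H.FiniteIndex ∧ IsSolvable ↥H} =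
      ⋃ ι : SubIdx k N, ⋂ w : dser (subOf ι) L, {a | FreeGroup.lift a (w : FreeGroup (Fin k)) = 1} := by
    ext a
    simp only [Set.mem_ofPred_eq, Set.mem_iUnion, Set.mem_iInter, Subtype.forall]
    exact main_iff d k N L hcl a
  rw [this]
  exact ZC.iUnion fun ι => ZC.iInter fun w => zc_word _

end Final


/-- **The virtually solvable tuples form a Zariski-closed set.** For all `d, k ≥ 1` there is a
set `S` of polynomials in the `k·d²` matrix entries such that a `k`-tuple of elements of
`GL_d(ℂ)` generates a virtually solvable subgroup if and only if all polynomials of `S` vanish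
at the tuple of its matrix entries. -/
theorem virtually_solvable_is_zariski_closed (d k : ℕ) (hd : 1 ≤ d) (hk : 1 ≤ k) :
    ∃ S : Set (MvPolynomial (Fin k × Fin d × Fin d) ℂ),
      ∀ a : Fin k → GL (Fin d) ℂ,
        (∃ H : Subgroup ↥(Subgroup.closure (Set.range a)), H.FiniteIndex ∧ IsSolvable ↥H) ↔
          ∀ P ∈ S,
            MvPolynomial.eval
              (fun x : Fin k × Fin d × Fin d =>
                (a x.1 : Matrix (Fin d) (Fin d) ℂ) x.2.1 x.2.2) P = 0 := by
  exact zc_main d k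
end

section
/- For every integer d ≥ 1 there exists an integer N = N(d) such that for every integer k ≥ 1 and every tuple (a_1, …, a_k) ∈ GL_d(ℂ)^k, the subgroup generated by a_1, …, a_k is virtually solvable if and only if there exists a nonempty finite set S of complete flags of ℂ^d with |S| ≤ N which is invariant under the action of each a_i (i.e., a_i maps each flag in S to a flag in S). -/
open scoped MatrixGroups

/-- `V` is a complete flag of `ℂ^d`: an increasing chain `V 0 ⊆ V 1 ⊆ ⋯ ⊆ V d` of subspaces
with `dim V i = i` (so in particular `V 0 = 0` and `V d = ℂ^d`). -/
def IsCompleteFlag (d : ℕ) (V : Fin (d + 1) → Submodule ℂ (Fin d → ℂ)) : Prop :=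
  Monotone V ∧ ∀ i : Fin (d + 1), Module.finrank ℂ (V i) = (i : ℕ)


/-- Bounded index criterion. -/
theorem index_le_of_sep {G : Type*} [Group G] (H : Subgroup G) (n : ℕ)
    (h : ∀ T : Finset G, (∀ x ∈ T, ∀ y ∈ T, x ≠ y → x⁻¹ * y ∉ H) → T.card ≤ n) :
    H.index ≠ 0 ∧ H.index ≤ n := by
  classical
  have key : ∀ T : Finset (G ⧸ H), T.card ≤ n := by
    intro T
    have := h (T.image Quotient.out) (by
      intro x hx y hy hxy hm
      simp only [Finset.mem_image] at hx hy
      obtain ⟨p, -, rfl⟩ := hx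
      obtain ⟨q, -, rfl⟩ := hy
      apply hxy
      have := QuotientGroup.eq.2 hm
      rw [QuotientGroup.out_eq', QuotientGroup.out_eq'] at this
      rw [this])
    rwa [Finset.card_image_of_injective _ Quotient.out_injective] at this
  have hfin : Finite (G ⧸ H) := by
    by_contra hinf
    rw [not_finite_iff_infinite] at hinf
    obtain ⟨T, hT⟩ := Infinite.exists_subset_card_eq (G ⧸ H) (n+1)
    have := key T
    omega
  have := Fintype.ofFinite (G ⧸ H)
  refine ⟨?_, ?_⟩
  · have : H.FiniteIndex := Subgroup.finiteIndex_of_finite_quotient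
    exact Subgroup.FiniteIndex.index_ne_zero
  · rw [Subgroup.index, Nat.card_eq_fintype_card]
    exact key Finset.univ

open Module in
/-- isometric case -/
theorem jordan_isometric {G : Type*} [Group G] {W : Type*} [NormedAddCommGroup W]
    [NormedSpace ℂ W] [FiniteDimensional ℂ W] (τ : G →* (W →L[ℂ] W))
    (hfin : (Set.range τ).Finite) (hiso : ∀ g w, ‖τ g w‖ = ‖w‖) (hnt : ∃ g, τ g ≠ 1) :
    ∃ g, τ g ≠ 1 ∧ ∃ H : Subgroup G, H.index ≠ 0 ∧ H.index ≤ 5 ^ (2 * (finrank ℂ W) ^ 2) ∧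
      ∀ h ∈ H, τ h * τ g = τ g * τ h := by
  classical
  have hn1 : ∀ g, ‖τ g‖ ≤ 1 := fun g =>
    ContinuousLinearMap.opNorm_le_bound _ zero_le_one (fun w => by rw [hiso, one_mul])
  obtain ⟨g, hg, hmin⟩ : ∃ g, τ g ≠ 1 ∧ ∀ k, τ k ≠ 1 → ‖τ g - 1‖ ≤ ‖τ k - 1‖ := by
    have hf2 : (Set.range τ \ {1}).Finite := hfin.sdiff
    obtain ⟨x, hx, hxm⟩ := Set.exists_min_image _ (fun x => ‖x - 1‖) hf2 (by
      obtain ⟨g, hg⟩ := hnt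
      exact ⟨τ g, ⟨g, rfl⟩, hg⟩)
    obtain ⟨⟨g, rfl⟩, hg⟩ := hx
    exact ⟨g, hg, fun k hk => hxm _ ⟨⟨k, rfl⟩, hk⟩⟩
  have hinv : ∀ k, τ k * τ k⁻¹ = 1 := fun k => by rw [← map_mul, mul_inv_cancel, map_one]
  have hinv' : ∀ k, τ k⁻¹ * τ k = 1 := fun k => by rw [← map_mul, inv_mul_cancel, map_one]
  let H : Subgroup G :=
    { carrier := {h | τ h * τ g = τ g * τ h}
      mul_mem' := by
        intro a b ha hb
        simp only [Set.mem_ofPred_eq, map_mul] at *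
        rw [mul_assoc, hb, ← mul_assoc, ha, mul_assoc]
      one_mem' := by simp
      inv_mem' := by
        intro a ha
        simp only [Set.mem_ofPred_eq] at *
        calc τ a⁻¹ * τ g = τ a⁻¹ * (τ g * τ a) * τ a⁻¹ := by
              rw [mul_assoc, mul_assoc, hinv, mul_one]
          _ = τ g * τ a⁻¹ := by rw [← ha, ← mul_assoc, hinv', one_mul] }
  have hpos : 0 < ‖τ g - 1‖ := norm_pos_iff.2 (sub_ne_zero.2 hg)
  have hclose : ∀ h, ‖τ h - 1‖ < 1 / 2 → h ∈ H := by
    intro h hh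
    by_contra hm
    have hk : τ (g * h * (g⁻¹ * h⁻¹)) ≠ 1 := by
      intro hk
      apply hm
      change τ h * τ g = τ g * τ h
      have h2 : τ (g * h * (g⁻¹ * h⁻¹)) * τ (h * g) = τ (g * h) := by
        rw [← map_mul]; congr 1; group
      rw [hk, one_mul, map_mul, map_mul] at h2
      exact h2
    have h1 := hmin _ hk
    have h3 : τ (g * h * (g⁻¹ * h⁻¹)) - 1
        = ((τ g - 1) * (τ h - 1) - (τ h - 1) * (τ g - 1)) * τ (g⁻¹ * h⁻¹) := by
      have e1 : (1 : W →L[ℂ] W) = τ (h * g) * τ (g⁻¹ * h⁻¹) := by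
        rw [← map_mul, ← map_one τ]; congr 1; group
      have e2 : (τ g - 1) * (τ h - 1) - (τ h - 1) * (τ g - 1) = τ g * τ h - τ h * τ g := by
        noncomm_ring
      rw [e2, sub_mul, ← map_mul τ h g, ← e1, ← map_mul, ← map_mul]
    have h4 : ‖τ (g * h * (g⁻¹ * h⁻¹)) - 1‖ ≤ 2 * ‖τ g - 1‖ * ‖τ h - 1‖ := by
      rw [h3]
      calc _ ≤ ‖(τ g - 1) * (τ h - 1) - (τ h - 1) * (τ g - 1)‖ * ‖τ (g⁻¹ * h⁻¹)‖ :=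
            norm_mul_le _ _
        _ ≤ ‖(τ g - 1) * (τ h - 1) - (τ h - 1) * (τ g - 1)‖ * 1 := by
            gcongr; exact hn1 _
        _ ≤ ‖(τ g - 1) * (τ h - 1)‖ + ‖(τ h - 1) * (τ g - 1)‖ := by
            rw [mul_one]; exact norm_sub_le _ _
        _ ≤ ‖τ g - 1‖ * ‖τ h - 1‖ + ‖τ h - 1‖ * ‖τ g - 1‖ :=
            add_le_add (norm_mul_le _ _) (norm_mul_le _ _)
        _ = _ := by ring
    nlinarith
  refine ⟨g, hg, H, ?_⟩
  have hidx := index_le_of_sep H (5 ^ (2 * (finrank ℂ W) ^ 2)) (by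
    intro T hT
    have hsep : ∀ x ∈ T, ∀ y ∈ T, x ≠ y → 1 / 2 ≤ ‖τ x - τ y‖ := by
      intro x hx y hy hxy
      by_contra hlt
      push Not at hlt
      apply hT x hx y hy hxy
      apply hclose
      have : τ (x⁻¹ * y) - 1 = - (τ x⁻¹ * (τ x - τ y)) := by
        rw [mul_sub, hinv', map_mul, neg_sub]
      rw [this, norm_neg]
      calc _ ≤ ‖τ x⁻¹‖ * ‖τ x - τ y‖ := norm_mul_le _ _
        _ ≤ 1 * ‖τ x - τ y‖ := by gcongr; exact hn1 _
        _ < 1 / 2 := by rw [one_mul]; exact hlt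
    have hinj : Set.InjOn (fun x => (2 : ℝ) • τ x) T := by
      intro x hx y hy hxy
      by_contra hne
      have := hsep x hx y hy hne
      have h2 : τ x = τ y := smul_right_injective _ (two_ne_zero) hxy
      rw [h2, sub_self, norm_zero] at this
      norm_num at this
    rw [← Finset.card_image_of_injOn hinj]
    have hc := Besicovitch.card_le_of_separated (T.image (fun x => (2 : ℝ) • τ x)) (by
      intro c hc
      obtain ⟨x, -, rfl⟩ := Finset.mem_image.1 hc
      rw [norm_smul]
      have := hn1 x
      norm_num
      linarith) (by
      intro c hc d hd hcd
      obtain ⟨x, hx, rfl⟩ := Finset.mem_image.1 hc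
      obtain ⟨y, hy, rfl⟩ := Finset.mem_image.1 hd
      have := hsep x hx y hy (fun h => hcd (by rw [h]))
      rw [← smul_sub, norm_smul]
      norm_num
      linarith)
    refine hc.trans (le_of_eq ?_)
    congr 1
    rw [finrank_real_of_complex, ← (LinearMap.toContinuousLinearMap (𝕜 := ℂ) (E := W) (F' := W)).finrank_eq,
      Module.finrank_linearMap, sq])
  exact ⟨hidx.1, hidx.2, fun h hh => hh⟩

open Module in
/-- finite-range case -/
theorem jordan_finite {G : Type*} [Group G] {W : Type*} [AddCommGroup W]
    [Module ℂ W] [FiniteDimensional ℂ W] (σ : G →* Module.End ℂ W)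
    (hfin : (Set.range σ).Finite) (hnt : ∃ g, σ g ≠ 1) :
    ∃ g, σ g ≠ 1 ∧ ∃ H : Subgroup G, H.index ≠ 0 ∧ H.index ≤ 5 ^ (2 * (finrank ℂ W) ^ 2) ∧
      ∀ h ∈ H, σ h * σ g = σ g * σ h := by
  classical
  have : Fintype (Set.range σ) := hfin.fintype
  let b := Module.finBasis ℂ W
  let Φ : W →ₗ[ℂ] (Set.range σ → Fin (finrank ℂ W) → ℂ) :=
    LinearMap.pi (fun f => b.equivFun.toLinearMap ∘ₗ f.1)
  have hΦ : Function.Injective Φ := by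
    intro x y hxy
    have := congrFun hxy ⟨σ 1, 1, rfl⟩
    simpa [Φ] using this
  let _ : NormedAddCommGroup W := NormedAddCommGroup.induced W _ Φ hΦ
  let _ : NormedSpace ℂ W := NormedSpace.induced ℂ W _ Φ
  have hle : ∀ g w, ‖σ g w‖ ≤ ‖w‖ := by
    intro g w
    change ‖Φ (σ g w)‖ ≤ ‖Φ w‖
    rw [pi_norm_le_iff_of_nonneg (norm_nonneg _)]
    rintro ⟨_, k, rfl⟩
    have : Φ (σ g w) ⟨_, k, rfl⟩ = Φ w ⟨_, k * g, rfl⟩ := by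
      simp [Φ]
    rw [this]
    exact norm_le_pi_norm _ _
  let e : Module.End ℂ W ≃ₐ[ℂ] (W →L[ℂ] W) := Module.End.toContinuousLinearMap W
  let τ : G →* (W →L[ℂ] W) := (e : Module.End ℂ W →* (W →L[ℂ] W)).comp σ
  have hτ : ∀ g, τ g = e (σ g) := fun g => rfl
  have h1 : ∀ g, τ g ≠ 1 ↔ σ g ≠ 1 := by
    intro g
    rw [hτ, ne_eq, EmbeddingLike.map_eq_one_iff]
  obtain ⟨g, hg, H, h2, h3, h4⟩ := jordan_isometric τ (by
    have : Set.range τ = e '' Set.range σ := by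
      ext x; simp [hτ]
    rw [this]; exact hfin.image _) (by
    intro g w
    refine le_antisymm (hle g w) ?_
    have := hle g⁻¹ (σ g w)
    rwa [← Module.End.mul_apply, ← map_mul, inv_mul_cancel, map_one] at this) (by
    obtain ⟨g, hg⟩ := hnt
    exact ⟨g, (h1 g).2 hg⟩)
  refine ⟨g, (h1 g).1 hg, H, h2, h3, fun h hh => ?_⟩
  have := h4 h hh
  rw [hτ, hτ, ← map_mul e, ← map_mul e] at this
  exact e.injective this


open Module

/-- A subgroup commuting with a non-scalar operator is reducible. -/
theorem reducible_of_commute {G : Type*} [Group G] {V : Type*} [AddCommGroup V]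
    [Module ℂ V] [FiniteDimensional ℂ V] (ρ : G →* Module.End ℂ V) (f : Module.End ℂ V)
    (hf : ∀ c : ℂ, f ≠ c • 1) (H : Subgroup G) (hH : ∀ h ∈ H, ρ h * f = f * ρ h) :
    ∃ W : Submodule ℂ V, W ≠ ⊥ ∧ W ≠ ⊤ ∧ ∀ h ∈ H, ∀ w ∈ W, ρ h w ∈ W := by
  have hnt : Nontrivial V := by
    by_contra hV
    rw [not_nontrivial_iff_subsingleton] at hV
    exact hf 0 (Subsingleton.elim _ _)
  obtain ⟨c, hc⟩ := Module.End.exists_eigenvalue f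
  refine ⟨f.eigenspace c, hc, ?_, ?_⟩
  · intro htop
    apply hf c
    ext v
    have : v ∈ f.eigenspace c := by rw [htop]; trivial
    simpa using Module.End.mem_eigenspace_iff.1 this
  · intro h hh w hw
    rw [Module.End.mem_eigenspace_iff] at hw ⊢
    rw [← Module.End.mul_apply, ← hH h hh, Module.End.mul_apply, hw, map_smul]

/-- From commuting up to scalars to commuting. -/
theorem commute_of_scalar_commute {G : Type*} [Group G] {V : Type*} [AddCommGroup V]
    [Module ℂ V] [FiniteDimensional ℂ V] (ρ : G →* Module.End ℂ V) (b : G)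
    (hV : 0 < finrank ℂ V)
    (H : Subgroup G) (m : ℕ) (h0 : H.index ≠ 0) (hm : H.index ≤ m)
    (hH : ∀ h ∈ H, ∃ c : ℂ, ρ h * ρ b = c • (ρ b * ρ h)) :
    ∃ K : Subgroup G, K.index ≠ 0 ∧ K.index ≤ finrank ℂ V * m ∧
      ∀ h ∈ K, ρ h * ρ b = ρ b * ρ h := by
  classical
  have hinv : ∀ k, ρ k * ρ k⁻¹ = 1 := fun k => by rw [← map_mul, mul_inv_cancel, map_one]
  have hinv' : ∀ k, ρ k⁻¹ * ρ k = 1 := fun k => by rw [← map_mul, inv_mul_cancel, map_one]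
  let C : Subgroup G :=
    { carrier := {h | ρ h * ρ b = ρ b * ρ h}
      mul_mem' := by
        intro x y hx hy
        simp only [Set.mem_ofPred_eq, map_mul] at *
        rw [mul_assoc, hy, ← mul_assoc, hx, mul_assoc]
      one_mem' := by simp
      inv_mem' := by
        intro x hx
        simp only [Set.mem_ofPred_eq] at *
        calc ρ x⁻¹ * ρ b = ρ x⁻¹ * (ρ b * ρ x) * ρ x⁻¹ := by
              rw [mul_assoc, mul_assoc, hinv, mul_one]
          _ = ρ b * ρ x⁻¹ := by rw [← hx, ← mul_assoc, hinv', one_mul] }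
  have hC : ∀ h, h ∈ C ↔ ρ h * ρ b = ρ b * ρ h := fun h => Iff.rfl
  choose! c hc using hH
  have hroot : ∀ h ∈ H, c h ^ finrank ℂ V = 1 := by
    intro h hh
    have := congrArg LinearMap.det (hc h hh)
    rw [LinearMap.det_smul, map_mul, map_mul, mul_comm (LinearMap.det (ρ b))] at this
    have hne : ∀ k, LinearMap.det (ρ k) ≠ 0 := by
      intro k hk
      have := congrArg LinearMap.det (hinv k)
      rw [map_mul, hk, zero_mul, map_one] at this
      exact zero_ne_one this
    have h2 := mul_ne_zero (hne h) (hne b)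
    exact (mul_eq_right₀ h2).1 this.symm
  have hidx := index_le_of_sep (C.subgroupOf H) (finrank ℂ V) (by
    intro T hT
    have hinj : Set.InjOn (fun x : H => c x) T := by
      intro x hx y hy hxy
      by_contra hne
      apply hT x hx y hy hne
      rw [Subgroup.mem_subgroupOf, hC]
      have h1 := hc x x.2
      have h2 := hc y y.2
      simp only at hxy
      push_cast
      rw [map_mul, mul_assoc, h2, ← hxy, mul_smul_comm, ← mul_assoc]
      have h3 : ρ b * ρ (x : G)⁻¹ = c x • (ρ (x : G)⁻¹ * ρ b) := by
        calc ρ b * ρ (x : G)⁻¹ = ρ (x : G)⁻¹ * (ρ x * ρ b) * ρ (x : G)⁻¹ := by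
              rw [← mul_assoc (ρ (x : G)⁻¹), hinv', one_mul]
          _ = _ := by
              rw [h1, mul_smul_comm, smul_mul_assoc, mul_assoc, mul_assoc, hinv, mul_one]
      rw [← mul_assoc, h3, smul_mul_assoc]
    rw [← Finset.card_image_of_injOn hinj]
    calc _ ≤ (Polynomial.nthRootsFinset (finrank ℂ V) (1 : ℂ)).card := by
          apply Finset.card_le_card
          intro z hz
          obtain ⟨x, -, rfl⟩ := Finset.mem_image.1 hz
          rw [Polynomial.mem_nthRootsFinset hV]
          exact hroot x x.2
      _ ≤ _ := by
          rw [Polynomial.nthRootsFinset]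
          exact (Multiset.toFinset_card_le _).trans (Polynomial.card_nthRoots _ _))
  have hrel : (C ⊓ H).index = C.relIndex H * H.index := by
    rw [← Subgroup.relIndex_mul_index (inf_le_right : C ⊓ H ≤ H), Subgroup.inf_relIndex_right]
  refine ⟨C ⊓ H, ?_, ?_, fun h hh => hh.1⟩
  · rw [hrel]; exact mul_ne_zero hidx.1 h0
  · rw [hrel]; exact Nat.mul_le_mul hidx.2 hm

/-- Common eigenvector of a commuting family. -/
theorem exists_common_eigenvector {ι : Type*} {V : Type*} [AddCommGroup V]
    [Module ℂ V] [FiniteDimensional ℂ V] [Nontrivial V] (f : ι → Module.End ℂ V)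
    (hf : ∀ i j, f i * f j = f j * f i) :
    ∃ v : V, v ≠ 0 ∧ ∀ i, ∃ c : ℂ, f i v = c • v := by
  obtain ⟨U, ⟨hU0, hU⟩, hmin⟩ := WellFounded.has_min
    (wellFounded_lt : WellFounded ((· < ·) : Submodule ℂ V → Submodule ℂ V → Prop))
    {U | U ≠ ⊥ ∧ ∀ i, ∀ u ∈ U, f i u ∈ U} ⟨⊤, top_ne_bot, fun _ _ _ => trivial⟩
  obtain ⟨v, hv, hv0⟩ := Submodule.exists_mem_ne_zero_of_ne_bot hU0
  refine ⟨v, hv0, fun i => ?_⟩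
  have : Nontrivial U := Submodule.nontrivial_iff_ne_bot.2 hU0
  obtain ⟨c, hc⟩ := Module.End.exists_eigenvalue ((f i).restrict (hU i))
  obtain ⟨u, hu⟩ := hc.exists_hasEigenvector
  have huc : f i u = c • (u : V) := by
    have := hu.apply_eq_smul
    simpa using congrArg Subtype.val this
  refine ⟨c, ?_⟩
  have hle : U ⊓ (f i).eigenspace c ≤ U := inf_le_left
  have hEq : U ⊓ (f i).eigenspace c = U := by
    by_contra hne
    refine hmin (U ⊓ (f i).eigenspace c) ⟨?_, ?_⟩ (lt_of_le_of_ne hle hne)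
    · intro hbot
      have : (u : V) ∈ U ⊓ (f i).eigenspace c := ⟨u.2, Module.End.mem_eigenspace_iff.2 huc⟩
      rw [hbot, Submodule.mem_bot] at this
      exact hu.2 (Subtype.ext this)
    · rintro j w ⟨hw1, hw2⟩
      refine ⟨hU j w hw1, ?_⟩
      rw [SetLike.mem_coe, Module.End.mem_eigenspace_iff] at *
      rw [← Module.End.mul_apply, hf, Module.End.mul_apply, hw2, map_smul]
  rw [← hEq] at hv
  exact Module.End.mem_eigenspace_iff.1 hv.2

/-- abelian normal nonscalar subgroup. -/
theorem reducible_of_abelian_normal {G : Type*} [Group G] {V : Type*} [AddCommGroup V]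
    [Module ℂ V] [FiniteDimensional ℂ V] (ρ : G →* Module.End ℂ V) (Z : Subgroup G)
    (hZn : Z.Normal) (hZc : ∀ x ∈ Z, ∀ y ∈ Z, ρ x * ρ y = ρ y * ρ x)
    (hns : ∃ z ∈ Z, ∀ c : ℂ, ρ z ≠ c • 1) :
    ∃ H : Subgroup G, H.index ≠ 0 ∧ H.index ≤ finrank ℂ V ∧
    ∃ W : Submodule ℂ V, W ≠ ⊥ ∧ W ≠ ⊤ ∧ ∀ h ∈ H, ∀ w ∈ W, ρ h w ∈ W := by
  classical
  obtain ⟨z₀, hz₀, hns⟩ := hns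
  have hnt : Nontrivial V := by
    by_contra hV
    rw [not_nontrivial_iff_subsingleton] at hV
    exact hns 0 (Subsingleton.elim _ _)
  obtain ⟨v, hv0, hv⟩ := exists_common_eigenvector (fun z : Z => ρ z)
    (fun x y => hZc x x.2 y y.2)
  choose χ hχ using hv
  -- the conjugation action on `Z`
  let cj : G → Z → Z := fun g z => ⟨g⁻¹ * z * g, by
    have := hZn.conj_mem z z.2 g⁻¹
    simpa using this⟩
  have hcj1 : ∀ z, cj 1 z = z := fun z => by simp [cj]
  have hcjm : ∀ g h z, cj (g * h) z = cj h (cj g z) := fun g h z => by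
    apply Subtype.ext; simp [cj]; group
  let H : Subgroup G :=
    { carrier := {h | ∀ z, χ (cj h z) = χ z}
      mul_mem' := by
        intro a b ha hb z
        rw [hcjm, hb, ha]
      one_mem' := fun z => by rw [hcj1]
      inv_mem' := by
        intro a ha z
        rw [← ha (cj a⁻¹ z), ← hcjm, inv_mul_cancel, hcj1] }
  have hH : ∀ h, h ∈ H ↔ ∀ z, χ (cj h z) = χ z := fun h => Iff.rfl
  have hmove : ∀ (g : G) (z : Z) (w : V), ρ z (ρ g w) = ρ g (ρ (cj g z) w) := by
    intro g z w
    rw [← Module.End.mul_apply, ← Module.End.mul_apply, ← map_mul, ← map_mul]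
    simp only [cj]
    congr 2
    group
  have hwt : ∀ (g : G) (z : Z), ρ z (ρ g v) = χ (cj g z) • ρ g v := by
    intro g z
    rw [hmove, hχ, map_smul]
  have hne : ∀ g, ρ g v ≠ 0 := by
    intro g hg
    apply hv0
    have : ρ g⁻¹ (ρ g v) = v := by
      rw [← Module.End.mul_apply, ← map_mul, inv_mul_cancel, map_one, Module.End.one_apply]
    rw [← this, hg, map_zero]
  have hind := Module.End.independent_iInf_maxGenEigenspace_of_forall_mapsTo (fun z : Z => ρ z)
    (fun i j φ => Module.End.mapsTo_maxGenEigenspace_of_comm (hZc j j.2 i i.2) φ)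
  have hidx := index_le_of_sep H (finrank ℂ V) (by
    intro T hT
    have hinj : Function.Injective (fun (x : T) => (fun z => χ (cj x z))) := by
      intro x y hxy
      by_contra hne
      apply hT x x.2 y y.2 (fun h => hne (Subtype.ext h))
      rw [hH]
      intro z
      have := congrFun hxy (cj (x : G)⁻¹ z)
      simp only [← hcjm, inv_mul_cancel, hcj1] at this
      exact this.symm
    have hli : LinearIndependent ℂ (fun x : T => ρ x v) :=
      (hind.comp hinj).linearIndependent _ (fun x => by
        simp only [Function.comp]
        rw [Submodule.mem_iInf]
        intro z
        have : ρ x v ∈ (ρ z).eigenspace (χ (cj x z)) :=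
          Module.End.mem_eigenspace_iff.2 (hwt x z)
        exact (Module.End.genEigenspace (ρ z) _).monotone le_top this) (fun x => hne x)
    simpa using hli.fintype_card_le_finrank)
  refine ⟨H, hidx.1, hidx.2, ⨅ z : Z, (ρ z).eigenspace (χ z), ?_, ?_, ?_⟩
  · intro hbot
    have : v ∈ ⨅ z : Z, (ρ z).eigenspace (χ z) := by
      rw [Submodule.mem_iInf]
      exact fun z => Module.End.mem_eigenspace_iff.2 (hχ z)
    rw [hbot] at this
    exact hv0 this
  · intro htop
    apply hns (χ ⟨z₀, hz₀⟩)
    ext w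
    have : w ∈ ⨅ z : Z, (ρ z).eigenspace (χ z) := by rw [htop]; trivial
    rw [Submodule.mem_iInf] at this
    simpa using Module.End.mem_eigenspace_iff.1 (this ⟨z₀, hz₀⟩)
  · intro h hh w hw
    rw [Submodule.mem_iInf] at hw ⊢
    intro z
    rw [Module.End.mem_eigenspace_iff, hmove, Module.End.mem_eigenspace_iff.1 (hw (cj h z)),
      map_smul, (hH h).1 hh]


open Module

/-- The subgroup of elements acting as scalars. -/
def scalarSubgroup {G : Type*} [Group G] {V : Type*} [AddCommGroup V]
    [Module ℂ V] (ρ : G →* Module.End ℂ V) : Subgroup G where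
  carrier := {g | ∃ c : ℂ, ρ g = c • 1}
  mul_mem' := by
    rintro a b ⟨c, hc⟩ ⟨e, he⟩
    exact ⟨c * e, by rw [map_mul, hc, he, smul_mul_smul_comm, one_mul]⟩
  one_mem' := ⟨1, by simp⟩
  inv_mem' := by
    rintro a ⟨c, hc⟩
    have h1 : ρ a * ρ a⁻¹ = 1 := by rw [← map_mul, mul_inv_cancel, map_one]
    rw [hc, smul_mul_assoc, one_mul] at h1
    by_cases h0 : c = 0
    · rw [h0, zero_smul] at h1
      refine ⟨0, ?_⟩
      rw [← mul_one (ρ a⁻¹), ← h1, mul_zero, smul_zero]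
    · refine ⟨c⁻¹, ?_⟩
      rw [← h1, smul_smul, inv_mul_cancel₀ h0, one_smul]

theorem mem_scalarSubgroup {G : Type*} [Group G] {V : Type*} [AddCommGroup V]
    [Module ℂ V] (ρ : G →* Module.End ℂ V) (g : G) :
    g ∈ scalarSubgroup ρ ↔ ∃ c : ℂ, ρ g = c • 1 := Iff.rfl

theorem scalarSubgroup_normal {G : Type*} [Group G] {V : Type*} [AddCommGroup V]
    [Module ℂ V] (ρ : G →* Module.End ℂ V) : (scalarSubgroup ρ).Normal := by
  constructor
  rintro n ⟨c, hc⟩ g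
  refine ⟨c, ?_⟩
  rw [map_mul, map_mul, hc, mul_smul_comm, mul_one, smul_mul_assoc, ← map_mul, mul_inv_cancel,
    map_one]

theorem scalar_comm_of_commutator {G : Type*} [Group G] {V : Type*} [AddCommGroup V]
    [Module ℂ V] (ρ : G →* Module.End ℂ V) (x y : G)
    (h : x * y * x⁻¹ * y⁻¹ ∈ scalarSubgroup ρ) :
    ∃ c : ℂ, ρ x * ρ y = c • (ρ y * ρ x) := by
  obtain ⟨c, hc⟩ := h
  refine ⟨c, ?_⟩
  have : ρ x * ρ y = ρ (x * y * x⁻¹ * y⁻¹) * (ρ y * ρ x) := by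
    rw [← map_mul, ← map_mul, ← map_mul]; congr 1; group
  rw [this, hc, smul_mul_assoc, one_mul]

/-- class two case -/
theorem reducible_of_class_two {G : Type*} [Group G] {V : Type*} [AddCommGroup V]
    [Module ℂ V] [FiniteDimensional ℂ V] (ρ : G →* Module.End ℂ V) (hV : 0 < finrank ℂ V)
    (B : Subgroup G) (hBn : B.Normal) (hBB : ⁅B, B⁆ ≤ scalarSubgroup ρ)
    (hB : ¬ B ≤ scalarSubgroup ρ) :
    ∃ H : Subgroup G, H.index ≠ 0 ∧
      H.index ≤ finrank ℂ V * (finrank ℂ V ^ 2 + 5 ^ (2 * (finrank ℂ V ^ 2) ^ 2)) ∧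
    ∃ W : Submodule ℂ V, W ≠ ⊥ ∧ W ≠ ⊤ ∧ ∀ h ∈ H, ∀ w ∈ W, ρ h w ∈ W := by
  classical
  have hinv : ∀ k, ρ k * ρ k⁻¹ = 1 := fun k => by rw [← map_mul, mul_inv_cancel, map_one]
  have hinv' : ∀ k, ρ k⁻¹ * ρ k = 1 := fun k => by rw [← map_mul, inv_mul_cancel, map_one]
  let Z : Subgroup G :=
    { carrier := {z | z ∈ B ∧ ∀ b ∈ B, ρ z * ρ b = ρ b * ρ z}
      mul_mem' := by
        rintro x y ⟨hxB, hx⟩ ⟨hyB, hy⟩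
        refine ⟨mul_mem hxB hyB, fun b hb => ?_⟩
        rw [map_mul, mul_assoc, hy b hb, ← mul_assoc, hx b hb, mul_assoc]
      one_mem' := ⟨one_mem _, by simp⟩
      inv_mem' := by
        rintro x ⟨hxB, hx⟩
        refine ⟨inv_mem hxB, fun b hb => ?_⟩
        calc ρ x⁻¹ * ρ b = ρ x⁻¹ * (ρ b * ρ x) * ρ x⁻¹ := by
              rw [mul_assoc, mul_assoc, hinv, mul_one]
          _ = ρ b * ρ x⁻¹ := by rw [← hx b hb, ← mul_assoc, hinv', one_mul] }
  have hZ : ∀ z, z ∈ Z ↔ z ∈ B ∧ ∀ b ∈ B, ρ z * ρ b = ρ b * ρ z := fun z => Iff.rfl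
  have hZn : Z.Normal := by
    constructor
    rintro n ⟨hnB, hn⟩ g
    refine ⟨hBn.conj_mem n hnB g, fun b hb => ?_⟩
    have h1 := hn (g⁻¹ * b * g) (by simpa using hBn.conj_mem b hb g⁻¹)
    rw [← map_mul, ← map_mul] at h1 ⊢
    calc ρ (g * n * g⁻¹ * b) = ρ g * ρ (n * (g⁻¹ * b * g)) * ρ g⁻¹ := by
          rw [← map_mul, ← map_mul]; congr 1; group
      _ = ρ (b * (g * n * g⁻¹)) := by
          rw [h1, ← map_mul, ← map_mul]; congr 1; group
  by_cases hZS : Z ≤ scalarSubgroup ρ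
  · obtain ⟨b, hbB, hbS⟩ := SetLike.not_le_iff_exists.1 hB
    have hSn := scalarSubgroup_normal ρ
    have htr : ∀ x ∈ B, x ∉ scalarSubgroup ρ → LinearMap.trace ℂ V (ρ x) = 0 := by
      intro x hx hxS
      have hxZ : x ∉ Z := fun h => hxS (hZS h)
      rw [hZ] at hxZ
      push Not at hxZ
      obtain ⟨y, hy, hxy⟩ := hxZ hx
      obtain ⟨c, hc⟩ := scalar_comm_of_commutator ρ x y
        (hBB (Subgroup.commutator_mem_commutator hx hy))
      have hc1 : c ≠ 1 := by
        rintro rfl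
        rw [one_smul] at hc
        exact hxy hc
      have h1 : ρ x = c • (ρ y * (ρ x * ρ y⁻¹)) := by
        calc ρ x = (ρ x * ρ y) * ρ y⁻¹ := by rw [mul_assoc, hinv, mul_one]
          _ = _ := by rw [hc, smul_mul_assoc, mul_assoc]
      have h2 := congrArg (LinearMap.trace ℂ V) h1
      rw [map_smul, LinearMap.trace_mul_comm, mul_assoc, hinv', mul_one, smul_eq_mul] at h2
      by_contra h0
      exact hc1 ((mul_eq_right₀ h0).1 h2.symm)
    let H₁ : Subgroup G := 
      { carrier := {h | h * b * h⁻¹ * b⁻¹ ∈ scalarSubgroup ρ}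
        mul_mem' := by
          intro x y hx hy
          have := mul_mem (hSn.conj_mem _ hy x) hx
          simp only [Set.mem_ofPred_eq]
          convert this using 1
          group
        one_mem' := by
          simp only [Set.mem_ofPred_eq]
          convert one_mem (scalarSubgroup ρ) using 1
          group
        inv_mem' := by
          intro x hx
          have := hSn.conj_mem _ (inv_mem hx) x⁻¹
          simp only [Set.mem_ofPred_eq]
          convert this using 1
          group }
    have hH₁ : ∀ h, h ∈ H₁ ↔ h * b * h⁻¹ * b⁻¹ ∈ scalarSubgroup ρ := fun h => Iff.rfl
    have hidx := index_le_of_sep H₁ (finrank ℂ V ^ 2) (by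
      intro T hT
      have hli : LinearIndependent ℂ (fun x : T => ρ (x * b * (x : G)⁻¹)) := by
        rw [Fintype.linearIndependent_iff]
        intro a ha i
        have h1 := congrArg (fun f => LinearMap.trace ℂ V (ρ (i * b * (i : G)⁻¹)⁻¹ * f)) ha
        simp only [Finset.mul_sum, map_sum, mul_smul_comm, map_smul, mul_zero, map_zero] at h1
        rw [Finset.sum_eq_single i] at h1
        · rw [hinv', LinearMap.trace_one, smul_eq_mul] at h1
          rcases mul_eq_zero.1 h1 with h | h
          · exact h
          · exact absurd h (by exact_mod_cast hV.ne')
        · intro j _ hji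
          rw [← map_mul, htr, smul_zero]
          · exact mul_mem (inv_mem (hBn.conj_mem _ hbB _)) (hBn.conj_mem _ hbB _)
          · intro hmem
            apply hT i i.2 j j.2 (fun h => hji (Subtype.ext h.symm))
            rw [hH₁]
            -- b⁻¹ (i⁻¹ j) b (i⁻¹j)⁻¹ conj
            have := hSn.conj_mem _ hmem (b * (i : G)⁻¹)
            convert this using 1
            group
        · intro h
          exact absurd (Finset.mem_univ i) h
      have := hli.fintype_card_le_finrank
      rw [Module.finrank_linearMap, ← sq] at this
      simpa using this)
    obtain ⟨K, hK0, hK1, hK⟩ := commute_of_scalar_commute ρ b hV H₁ _ hidx.1 hidx.2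
      (fun h hh => scalar_comm_of_commutator ρ h b hh)
    obtain ⟨W, hW⟩ := reducible_of_commute ρ (ρ b) (fun c hc => hbS ⟨c, hc⟩) K hK
    exact ⟨K, hK0, hK1.trans (Nat.mul_le_mul_left _ (by simp)), W, hW⟩
  · obtain ⟨z, hz, hzS⟩ := SetLike.not_le_iff_exists.1 hZS
    obtain ⟨H, h0, h1, h2⟩ := reducible_of_abelian_normal ρ Z hZn
      (fun x hx y hy => hx.2 y hy.1) ⟨z, hz, fun c hc => hzS ⟨c, hc⟩⟩
    refine ⟨H, h0, h1.trans ?_, h2⟩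
    apply Nat.le_mul_of_pos_right
    positivity

/-- conjugation action on endomorphisms -/
def adRep {G : Type*} [Group G] {V : Type*} [AddCommGroup V]
    [Module ℂ V] (ρ : G →* Module.End ℂ V) : G →* Module.End ℂ (Module.End ℂ V) where
  toFun g := LinearMap.mulLeft ℂ (ρ g) * LinearMap.mulRight ℂ (ρ g⁻¹)
  map_one' := by ext; simp
  map_mul' x y := by
    ext f v
    simp [Module.End.mul_apply]

theorem adRep_apply {G : Type*} [Group G] {V : Type*} [AddCommGroup V]
    [Module ℂ V] (ρ : G →* Module.End ℂ V) (g : G) (f : Module.End ℂ V) :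
    adRep ρ g f = ρ g * (f * ρ g⁻¹) := rfl

theorem adRep_eq_one_iff {G : Type*} [Group G] {V : Type*} [AddCommGroup V]
    [Module ℂ V] (ρ : G →* Module.End ℂ V) (g : G) :
    adRep ρ g = 1 ↔ g ∈ scalarSubgroup ρ := by
  have hinv' : ρ g⁻¹ * ρ g = 1 := by rw [← map_mul, inv_mul_cancel, map_one]
  have hinv : ρ g * ρ g⁻¹ = 1 := by rw [← map_mul, mul_inv_cancel, map_one]
  constructor
  · intro h
    have hc : ρ g ∈ Subalgebra.center ℂ (Module.End ℂ V) := by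
      rw [Subalgebra.mem_center_iff]
      intro f
      have := congrArg (fun F : Module.End ℂ (Module.End ℂ V) => F f * ρ g) h
      simp only [adRep_apply, Module.End.one_apply] at this
      rw [mul_assoc, mul_assoc, hinv', mul_one] at this
      exact this.symm
    obtain ⟨c, hc', hcc⟩ := Module.End.mem_subalgebraCenter_iff.1 hc
    refine ⟨c, ?_⟩
    rw [hcc]
    rfl
  · rintro ⟨c, hc⟩
    ext1 f
    have : ρ g * f = f * ρ g := by rw [hc]; simp
    rw [adRep_apply, ← mul_assoc, this, mul_assoc, hinv, mul_one, Module.End.one_apply]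

/-- scalars of finite index -/
theorem reducible_of_scalar_finiteIndex {G : Type*} [Group G] {V : Type*} [AddCommGroup V]
    [Module ℂ V] [FiniteDimensional ℂ V] (ρ : G →* Module.End ℂ V) (hV : 0 < finrank ℂ V)
    (hfi : (scalarSubgroup ρ).FiniteIndex) (hne : scalarSubgroup ρ ≠ ⊤) :
    ∃ H : Subgroup G, H.index ≠ 0 ∧
      H.index ≤ finrank ℂ V * (finrank ℂ V ^ 2 + 5 ^ (2 * (finrank ℂ V ^ 2) ^ 2)) ∧
    ∃ W : Submodule ℂ V, W ≠ ⊥ ∧ W ≠ ⊤ ∧ ∀ h ∈ H, ∀ w ∈ W, ρ h w ∈ W := by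
  have hfin : (Set.range (adRep ρ)).Finite := by
    have : Finite (G ⧸ scalarSubgroup ρ) := Subgroup.finite_quotient_of_finiteIndex
    refine (Set.finite_range (fun q : G ⧸ scalarSubgroup ρ => adRep ρ q.out)).subset ?_
    rintro _ ⟨g, rfl⟩
    refine ⟨(g : G ⧸ scalarSubgroup ρ), ?_⟩
    obtain ⟨h, hh⟩ := QuotientGroup.mk_out_eq_mul (scalarSubgroup ρ) g
    simp only
    rw [hh, map_mul, (adRep_eq_one_iff ρ h).2 h.2, mul_one]
  obtain ⟨g, hg⟩ : ∃ g, g ∉ scalarSubgroup ρ := by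
    by_contra hcon
    push Not at hcon
    exact hne (eq_top_iff.2 fun x _ => hcon x)
  obtain ⟨b, hb, H, h0, h1, h2⟩ := jordan_finite (adRep ρ) hfin
    ⟨g, fun h => hg ((adRep_eq_one_iff ρ g).1 h)⟩
  rw [Module.finrank_linearMap, ← sq] at h1
  obtain ⟨K, hK0, hK1, hK⟩ := commute_of_scalar_commute ρ b hV H _ h0 h1 (by
    intro h hh
    apply scalar_comm_of_commutator
    rw [← adRep_eq_one_iff]
    have := h2 h hh
    rw [← map_mul, ← map_mul] at this
    have e : h * b * h⁻¹ * b⁻¹ = (h * b) * (b * h)⁻¹ := by group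
    rw [e, map_mul, this, ← map_mul, mul_inv_cancel, map_one])
  obtain ⟨W, hW⟩ := reducible_of_commute ρ (ρ b)
    (fun c hc => hb ((adRep_eq_one_iff ρ b).2 ⟨c, hc⟩)) K hK
  exact ⟨K, hK0, hK1.trans (Nat.mul_le_mul_left _ (by simp)), W, hW⟩

/-- Virtually solvable -/
def VSolv (G : Type*) [Group G] : Prop := ∃ H : Subgroup G, H.FiniteIndex ∧ Group.IsSolvable H

theorem reducible_of_vsolv {G : Type*} [Group G] {V : Type*} [AddCommGroup V]
    [Module ℂ V] [FiniteDimensional ℂ V] (ρ : G →* Module.End ℂ V) (hV : 2 ≤ finrank ℂ V)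
    (hG : VSolv G) :
    ∃ H : Subgroup G, H.index ≠ 0 ∧
      H.index ≤ finrank ℂ V * (finrank ℂ V ^ 2 + 5 ^ (2 * (finrank ℂ V ^ 2) ^ 2)) ∧
    ∃ W : Submodule ℂ V, W ≠ ⊥ ∧ W ≠ ⊤ ∧ ∀ h ∈ H, ∀ w ∈ W, ρ h w ∈ W := by
  obtain ⟨H, hfi, hsol⟩ := hG
  let R := H.normalCore
  have hRfi : R.FiniteIndex := inferInstance
  have hRn : R.Normal := H.normalCore_normal
  have hRsol : Group.IsSolvable R :=
    Group.isSolvable_of_isSolvable_injective (Subgroup.inclusion_injective H.normalCore_le)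
  by_cases hRS : R ≤ scalarSubgroup ρ
  · by_cases htop : scalarSubgroup ρ = ⊤
    · -- everything is scalar
      have hnt : Nontrivial V := Module.nontrivial_of_finrank_pos (R := ℂ) (by omega)
      obtain ⟨v, hv⟩ := exists_ne (0 : V)
      refine ⟨⊤, by simp, ?_, Submodule.span ℂ {v}, ?_, ?_, ?_⟩
      · rw [Subgroup.index_top]
        apply Nat.succ_le_of_lt
        positivity
      · simpa using hv
      · intro h
        have := finrank_span_singleton (K := ℂ) hv
        rw [h, finrank_top] at this
        omega
      · intro h _ w hw
        have : h ∈ scalarSubgroup ρ := by rw [htop]; trivial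
        obtain ⟨c, hc⟩ := this
        rw [hc]
        exact Submodule.smul_mem _ _ hw
    · exact reducible_of_scalar_finiteIndex ρ (by omega)
        (Subgroup.finiteIndex_of_le hRS) htop
  · let D : ℕ → Subgroup G := fun n => (derivedSeries R n).map R.subtype
    have hDs : ∀ n, D (n + 1) = ⁅D n, D n⁆ := fun n => by
      simp only [D, derivedSeries_succ, Subgroup.map_commutator]
    have hD0 : D 0 = R := by
      simp only [D, derivedSeries_zero]
      rw [← MonoidHom.range_eq_map, Subgroup.range_subtype]
    have hDn : ∀ n, (D n).Normal := by
      intro n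
      induction n with
      | zero => rw [hD0]; exact hRn
      | succ n ih => rw [hDs]; infer_instance
    obtain ⟨m, hm⟩ := hRsol.solvable
    have hex : ∃ n, D n ≤ scalarSubgroup ρ := ⟨m, by simp [D, hm]⟩
    classical
    let n := Nat.find hex
    have hn : D n ≤ scalarSubgroup ρ := Nat.find_spec hex
    have hn0 : n ≠ 0 := by
      intro h
      rw [h, hD0] at hn
      exact hRS hn
    obtain ⟨p, hp⟩ := Nat.exists_eq_succ_of_ne_zero hn0
    have hpn : ¬ D p ≤ scalarSubgroup ρ := Nat.find_min hex (by change p < n; omega)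
    rw [hp, Nat.succ_eq_add_one, hDs] at hn
    exact reducible_of_class_two ρ (by omega) (D p) (hDn p) hn hpn


open Module
open scoped commutatorElement

theorem VSolv.subgroup {G : Type*} [Group G] (hG : VSolv G) (K : Subgroup G) : VSolv K := by
  obtain ⟨H, hfi, hsol⟩ := hG
  refine ⟨H.subgroupOf K, inferInstance, ?_⟩
  let φ : H.subgroupOf K →* H :=
    { toFun := fun x => ⟨x.1.1, x.2⟩
      map_one' := rfl
      map_mul' := fun _ _ => rfl }
  refine Group.isSolvable_of_isSolvable_injective (f := φ) ?_
  intro x y hxy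
  apply Subtype.ext
  apply Subtype.ext
  exact congrArg (fun z : H => (z : G)) hxy

/-- bounded index subgroup fixing a line -/
theorem exists_line (n : ℕ) : ∃ N : ℕ, ∀ (G : Type) [Group G] (V : Type) [AddCommGroup V]
    [Module ℂ V] [FiniteDimensional ℂ V] (ρ : G →* Module.End ℂ V), VSolv G →
    finrank ℂ V = n → 0 < n →
    ∃ H : Subgroup G, H.index ≠ 0 ∧ H.index ≤ N ∧
      ∃ v : V, v ≠ 0 ∧ ∀ h ∈ H, ∃ c : ℂ, ρ h v = c • v := by
  induction n using Nat.strong_induction_on with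
  | _ n ih =>
  choose! B hB using ih
  refine ⟨1 + (∑ m ∈ Finset.range n, B m) * (n * (n ^ 2 + 5 ^ (2 * (n ^ 2) ^ 2))), ?_⟩
  intro G _ V _ _ _ ρ hG hn hpos
  by_cases h1 : n = 1
  · subst h1
    obtain ⟨v, hv, hs⟩ := finrank_eq_one_iff'.1 hn
    refine ⟨⊤, by simp, by simp, v, hv, fun h _ => ?_⟩
    obtain ⟨c, hc⟩ := hs (ρ h v)
    exact ⟨c, hc.symm⟩
  · obtain ⟨H, h0, hle, W, hW0, hWt, hW⟩ := reducible_of_vsolv ρ (by omega) hG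
    rw [hn] at hle
    let ρ' : H →* Module.End ℂ W :=
      { toFun := fun h => (ρ h).restrict (hW h h.2)
        map_one' := by ext; simp
        map_mul' := fun x y => by ext; simp }
    have hlt : finrank ℂ W < n := by
      rw [← hn]; exact Submodule.finrank_lt hWt
    have hp : 0 < finrank ℂ W := by
      rw [Nat.pos_iff_ne_zero, ne_eq, Submodule.finrank_eq_zero]; exact hW0
    obtain ⟨K, hK0, hK1, v, hv, hKv⟩ := hB _ hlt H W ρ' (hG.subgroup H) rfl hp
    refine ⟨K.map H.subtype, ?_, ?_, v, by simpa using hv, ?_⟩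
    · rw [Subgroup.index_map_subtype]; exact mul_ne_zero hK0 h0
    · rw [Subgroup.index_map_subtype]
      refine le_trans (Nat.mul_le_mul (hK1.trans ?_) hle) (Nat.le_add_left _ _)
      exact Finset.single_le_sum (f := B) (fun _ _ => Nat.zero_le _) (Finset.mem_range.2 hlt)
    · rintro _ ⟨h, hh, rfl⟩
      obtain ⟨c, hc⟩ := hKv h hh
      exact ⟨c, congrArg Subtype.val hc⟩

/-- bounded index subgroup fixing a partial flag -/
theorem exists_partial_flag (d i : ℕ) (hi : i ≤ d) : ∃ N : ℕ, ∀ (G : Type) [Group G]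
    (V : Type) [AddCommGroup V]
    [Module ℂ V] [FiniteDimensional ℂ V] (ρ : G →* Module.End ℂ V), VSolv G →
    finrank ℂ V = d →
    ∃ H : Subgroup G, H.index ≠ 0 ∧ H.index ≤ N ∧
      ∃ f : ℕ → Submodule ℂ V, (∀ j ≤ i, finrank ℂ (f j) = j) ∧ (∀ j < i, f j ≤ f (j + 1)) ∧
        ∀ j ≤ i, ∀ h ∈ H, ∀ w ∈ f j, ρ h w ∈ f j := by
  induction i with
  | zero =>
    refine ⟨1, ?_⟩
    intro G _ V _ _ _ ρ hG hn
    refine ⟨⊤, by simp, by simp, fun _ => ⊥, ?_, ?_, ?_⟩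
    · intro j hj; simp; omega
    · intro j hj; simp
    · intro j hj h _ w hw
      rw [Submodule.mem_bot] at *
      rw [hw, map_zero]
  | succ i ih =>
    obtain ⟨N, hN⟩ := ih (by omega)
    obtain ⟨M, hM⟩ := exists_line (d - i)
    refine ⟨M * N, ?_⟩
    intro G _ V _ _ _ ρ hG hn
    obtain ⟨H, h0, h1, f, hf1, hf2, hf3⟩ := hN G V ρ hG hn
    let ρ' : H →* Module.End ℂ (V ⧸ f i) :=
      { toFun := fun h => (f i).mapQ (f i) (ρ h) (fun w hw => hf3 i le_rfl h h.2 w hw)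
        map_one' := by ext; simp
        map_mul' := fun x y => by ext; simp }
    have hq : finrank ℂ (V ⧸ f i) = d - i := by
      have := Submodule.finrank_quotient_add_finrank (f i)
      rw [hf1 i le_rfl] at this
      omega
    obtain ⟨K, hK0, hK1, v, hv, hKv⟩ := hM H (V ⧸ f i) ρ' (hG.subgroup H) hq (by omega)
    obtain ⟨v, rfl⟩ := (f i).mkQ_surjective v
    have hvn : v ∉ f i := by
      intro h
      exact hv (by simpa using h)
    refine ⟨K.map H.subtype, ?_, ?_, fun j => if j ≤ i then f j else f i ⊔ Submodule.span ℂ {v},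
      ?_, ?_, ?_⟩
    · rw [Subgroup.index_map_subtype]; exact mul_ne_zero hK0 h0
    · rw [Subgroup.index_map_subtype]
      exact Nat.mul_le_mul hK1 h1
    · intro j hj
      by_cases hji : j ≤ i
      · exact (congrArg (fun U : Submodule ℂ V => finrank ℂ U) (if_pos hji)).trans (hf1 j hji)
      · refine (congrArg (fun U : Submodule ℂ V => finrank ℂ U) (if_neg hji)).trans ?_
        rw [Submodule.finrank_sup_span_singleton hvn, hf1 i le_rfl]; omega
    · intro j hj
      simp only
      rw [if_pos (by omega : j ≤ i)]
      split_ifs with hji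
      · exact hf2 j (by omega)
      · have : j = i := by omega
        rw [this]; exact le_sup_left
    · rintro j hj _ ⟨h, hh, rfl⟩ w hw
      simp only at hw ⊢
      split_ifs at hw ⊢ with hji
      · exact hf3 j hji h h.2 w hw
      · obtain ⟨c, hc⟩ := hKv h hh
        obtain ⟨u, hu, t, ht, rfl⟩ := Submodule.mem_sup.1 hw
        obtain ⟨e, rfl⟩ := Submodule.mem_span_singleton.1 ht
        have hmem : ρ h v - c • v ∈ f i := by
          rw [← Submodule.Quotient.eq]
          exact hc
        have e1 : ρ h (u + e • v) = (ρ h u + e • (ρ h v - c • v)) + (e * c) • v := by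
          rw [map_add, map_smul, smul_sub, smul_smul]; abel
        refine Submodule.mem_sup.2 ⟨_, ?_, _, Submodule.smul_mem _ (e * c)
          (Submodule.mem_span_singleton_self v), e1.symm⟩
        exact add_mem (hf3 i le_rfl h h.2 u hu) (Submodule.smul_mem _ _ hmem)

/-- A group faithfully preserving a complete flag is solvable. -/
theorem solvable_of_flag {G : Type*} [Group G] {V : Type*} [AddCommGroup V]
    [Module ℂ V] [FiniteDimensional ℂ V] (ρ : G →* Module.End ℂ V) (hρ : Function.Injective ρ)
    (f : ℕ → Submodule ℂ V) (d : ℕ) (hd : finrank ℂ V = d) (hf1 : ∀ j ≤ d, finrank ℂ (f j) = j)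
    (hf2 : ∀ j < d, f j ≤ f (j + 1)) (hf3 : ∀ j ≤ d, ∀ g, ∀ w ∈ f j, ρ g w ∈ f j) :
    Group.IsSolvable G := by
  have hinv' : ∀ k v, ρ k⁻¹ (ρ k v) = v := fun k v => by
    rw [← Module.End.mul_apply, ← map_mul, inv_mul_cancel, map_one, Module.End.one_apply]
  have key : ∀ i ≤ d, ∀ g ∈ derivedSeries G (2 * i), ∀ v ∈ f i, ρ g v = v := by
    intro i
    induction i with
    | zero =>
      intro _ g _ v hv
      have : f 0 = ⊥ := Submodule.finrank_eq_zero.1 (hf1 0 (by omega))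
      rw [this, Submodule.mem_bot] at hv
      rw [hv, map_zero]
    | succ i ih =>
      intro hi
      have ih := ih (by omega)
      have hle := hf2 i (by omega)
      obtain ⟨v, hv, hvn⟩ : ∃ v ∈ f (i + 1), v ∉ f i := by
        by_contra hcon
        push Not at hcon
        have h2 := Submodule.finrank_mono (R := ℂ) (show f (i + 1) ≤ f i from hcon)
        rw [hf1 _ hi, hf1 _ (by omega)] at h2
        omega
      have hsup : f i ⊔ Submodule.span ℂ {v} = f (i + 1) := by
        apply Submodule.eq_of_le_of_finrank_eq
        · exact sup_le hle (by simpa using hv)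
        · rw [Submodule.finrank_sup_span_singleton hvn, hf1 _ hi, hf1 _ (by omega)]
      have hdec : ∀ x ∈ f (i + 1), ∃ u ∈ f i, ∃ c : ℂ, x = u + c • v := by
        intro x hx
        rw [← hsup] at hx
        obtain ⟨u, hu, t, ht, rfl⟩ := Submodule.mem_sup.1 hx
        obtain ⟨e, rfl⟩ := Submodule.mem_span_singleton.1 ht
        exact ⟨u, hu, e, rfl⟩
      let P : Subgroup G :=
        { carrier := {g | ∀ w ∈ f (i + 1), ρ g w - w ∈ f i}
          mul_mem' := by
            intro a b ha hb w hw
            have h1 := hf3 i (by omega) a _ (hb w hw)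
            have h2 := add_mem h1 (ha w hw)
            rw [map_mul, Module.End.mul_apply]
            rw [map_sub, sub_add_sub_cancel] at h2
            exact h2
          one_mem' := by
            intro w _
            simp
          inv_mem' := by
            intro a ha w hw
            have h1 := neg_mem (hf3 i (by omega) a⁻¹ _ (ha w hw))
            rw [map_sub, hinv', neg_sub] at h1
            exact h1 }
      let Q : Subgroup G :=
        { carrier := {g | ∀ w ∈ f (i + 1), ρ g w = w}
          mul_mem' := by
            intro a b ha hb w hw
            rw [map_mul, Module.End.mul_apply, hb w hw, ha w hw]
          one_mem' := by
            intro w _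
            simp
          inv_mem' := by
            intro a ha w hw
            have := hinv' a w
            rwa [ha w hw] at this }
      have hcomm : ∀ a b : G, ∀ w, ∃ x, (x = ρ (b * a)⁻¹ w) ∧ ρ ⁅a, b⁆ w = ρ a (ρ b x) ∧
          w = ρ b (ρ a x) := by
        intro a b w
        refine ⟨_, rfl, ?_, ?_⟩
        · rw [← Module.End.mul_apply, ← Module.End.mul_apply, ← map_mul, ← map_mul,
            commutatorElement_def]
          congr 2
          group
        · rw [← Module.End.mul_apply, ← Module.End.mul_apply, ← map_mul, ← map_mul,
            mul_inv_rev]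
          have : b * a * (a⁻¹ * b⁻¹) = 1 := by group
          rw [this, map_one, Module.End.one_apply]
      have hP : derivedSeries G (2 * i + 1) ≤ P := by
        rw [derivedSeries_succ, Subgroup.commutator_le]
        intro a _ b _ w hw
        obtain ⟨x, hx, h1, h2⟩ := hcomm a b w
        have hx' : x ∈ f (i + 1) := by rw [hx]; exact hf3 _ hi _ _ hw
        rw [h1]
        nth_rewrite 1 [h2]
        obtain ⟨u, hu, c, rfl⟩ := hdec x hx'
        obtain ⟨ua, hua, ca, ha⟩ := hdec _ (hf3 _ hi a v hv)
        obtain ⟨ub, hub, cb, hb⟩ := hdec _ (hf3 _ hi b v hv)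
        have hi' : i ≤ d := by omega
        have e : ρ a (ρ b (u + c • v)) - ρ b (ρ a (u + c • v))
            = (ρ a (ρ b u) - ρ b (ρ a u)) + c • ((ρ a ub + cb • ua) - (ρ b ua + ca • ub)) := by
          simp only [map_add, map_smul, ha, hb]
          module
        rw [e]
        exact add_mem (sub_mem (hf3 i hi' a _ (hf3 i hi' b _ hu))
          (hf3 i hi' b _ (hf3 i hi' a _ hu)))
          (Submodule.smul_mem _ _ (sub_mem
            (add_mem (hf3 i hi' a _ hub) (Submodule.smul_mem _ _ hua))
            (add_mem (hf3 i hi' b _ hua) (Submodule.smul_mem _ _ hub))))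
      have hQ : derivedSeries G (2 * (i + 1)) ≤ Q := by
        rw [show 2 * (i + 1) = (2 * i + 1) + 1 by ring, derivedSeries_succ,
          Subgroup.commutator_le]
        intro a ha b hb w hw
        obtain ⟨x, hx, h1, h2⟩ := hcomm a b w
        have hx' : x ∈ f (i + 1) := by rw [hx]; exact hf3 _ hi _ _ hw
        rw [h1]
        nth_rewrite 1 [h2]
        have ha1 := hP ha x hx'
        have hb1 := hP hb x hx'
        have ha2 := ih b (derivedSeries_antitone G (by omega) hb) _ ha1
        have hb2 := ih a (derivedSeries_antitone G (by omega) ha) _ hb1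
        rw [map_sub] at ha2 hb2
        rw [sub_eq_iff_eq_add] at ha2 hb2
        rw [ha2, hb2]
        abel
      exact fun g hg => hQ hg
  refine ⟨⟨2 * d, ?_⟩⟩
  rw [eq_bot_iff]
  intro g hg
  rw [Subgroup.mem_bot]
  apply hρ
  have htop : f d = ⊤ := Submodule.eq_top_of_finrank_eq (by rw [hf1 d le_rfl, hd])
  ext v
  rw [key d le_rfl g hg v (by rw [htop]; trivial), map_one, Module.End.one_apply]

/-- The standard representation. -/
def stdRep (d : ℕ) : GL (Fin d) ℂ →* Module.End ℂ (Fin d → ℂ) where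
  toFun g := Matrix.mulVecLin (g : Matrix (Fin d) (Fin d) ℂ)
  map_one' := by simp; rfl
  map_mul' x y := by
    rw [Units.val_mul, Matrix.mulVecLin_mul]; rfl

theorem stdRep_injective (d : ℕ) : Function.Injective (stdRep d) := by
  intro x y hxy
  apply Units.ext
  exact Matrix.mulVec_injective (congrArg DFunLike.coe hxy)

/-- Action on flags -/
def flagAct {d : ℕ} (g : GL (Fin d) ℂ) (F : Fin (d + 1) → Submodule ℂ (Fin d → ℂ)) :
    Fin (d + 1) → Submodule ℂ (Fin d → ℂ) := fun j => (F j).map (stdRep d g)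

theorem flagAct_one {d : ℕ} (F : Fin (d + 1) → Submodule ℂ (Fin d → ℂ)) : flagAct 1 F = F := by
  funext j
  simp only [flagAct, map_one]
  exact Submodule.map_id _

theorem flagAct_mul {d : ℕ} (g h : GL (Fin d) ℂ) (F : Fin (d + 1) → Submodule ℂ (Fin d → ℂ)) :
    flagAct (g * h) F = flagAct g (flagAct h F) := by
  funext j
  simp only [flagAct, map_mul]
  exact Submodule.map_comp _ _ _

theorem flagAct_flag {d : ℕ} (g : GL (Fin d) ℂ) (F : Fin (d + 1) → Submodule ℂ (Fin d → ℂ))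
    (hF : IsCompleteFlag d F) : IsCompleteFlag d (flagAct g F) := by
  refine ⟨fun i j hij => Submodule.map_mono (hF.1 hij), fun i => ?_⟩
  rw [← hF.2 i]
  have hinj : Function.Injective (stdRep d g) := by
    intro v w hvw
    have := congrArg (stdRep d g⁻¹) hvw
    simpa only [← Module.End.mul_apply, ← map_mul, inv_mul_cancel, map_one,
      Module.End.one_apply] using this
  exact (Submodule.equivMapOfInjective _ hinj (F i)).finrank_eq.symm

theorem virtually_solvable_iff_invariant_flags (d : ℕ) (hd : 1 ≤ d) :
    ∃ N : ℕ, ∀ (k : ℕ) (a : Fin k → GL (Fin d) ℂ),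
      (∃ H : Subgroup ↥(Subgroup.closure (Set.range a)), H.FiniteIndex ∧ IsSolvable ↥H) ↔
        ∃ S : Set (Fin (d + 1) → Submodule ℂ (Fin d → ℂ)),
          S.Finite ∧ S.Nonempty ∧ S.ncard ≤ N ∧
          (∀ V ∈ S, IsCompleteFlag d V) ∧
          (∀ i : Fin k, ∀ V ∈ S,
            (fun j => Submodule.map
              (Matrix.mulVecLin (a i : Matrix (Fin d) (Fin d) ℂ)) (V j)) ∈ S) := by
  classical
  obtain ⟨N, hN⟩ := exists_partial_flag d d le_rfl
  refine ⟨N, fun k a => ⟨?_, ?_⟩⟩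
  · intro hvs
    let Γ := Subgroup.closure (Set.range a)
    have hv : VSolv Γ := hvs
    obtain ⟨H, h0, h1, f, hf1, hf2, hf3⟩ := hN Γ (Fin d → ℂ) ((stdRep d).comp Γ.subtype) hv
      (by simp)
    let F : Fin (d + 1) → Submodule ℂ (Fin d → ℂ) := fun j => f j
    have hF : IsCompleteFlag d F := by
      refine ⟨?_, fun i => hf1 i (by omega)⟩
      rw [Fin.monotone_iff_le_succ]
      intro i
      exact hf2 i i.2
    have hfix : ∀ h ∈ H, flagAct (h : GL (Fin d) ℂ) F = F := by
      intro h hh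
      have hle : ∀ g ∈ H, ∀ j, flagAct (g : GL (Fin d) ℂ) F j ≤ F j := by
        intro g hg j
        rw [flagAct, Submodule.map_le_iff_le_comap]
        intro w hw
        exact hf3 j (by omega) g hg w hw
      funext j
      apply Submodule.eq_of_le_of_finrank_eq (hle h hh j)
      rw [(flagAct_flag _ F hF).2, hF.2]
    have : H.FiniteIndex := ⟨h0⟩
    have hfinq : Finite (Γ ⧸ H) := Subgroup.finite_quotient_of_finiteIndex
    let ψ : Γ ⧸ H → (Fin (d + 1) → Submodule ℂ (Fin d → ℂ)) :=
      fun q => flagAct ((q.out : Γ) : GL (Fin d) ℂ) F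
    have hψ : ∀ g : Γ, flagAct (g : GL (Fin d) ℂ) F ∈ Set.range ψ := by
      intro g
      refine ⟨(g : Γ ⧸ H), ?_⟩
      obtain ⟨h, hh⟩ := QuotientGroup.mk_out_eq_mul H g
      simp only [ψ]
      rw [hh, Subgroup.coe_mul, flagAct_mul, hfix h h.2]
    refine ⟨Set.range ψ, Set.finite_range ψ, ⟨_, hψ 1⟩, ?_, ?_, ?_⟩
    · refine le_trans ?_ h1
      rw [← Set.image_univ]
      refine (Set.ncard_image_le Set.finite_univ).trans ?_
      rw [Set.ncard_univ]
      rfl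
    · rintro _ ⟨q, rfl⟩
      exact flagAct_flag _ F hF
    · rintro i _ ⟨q, rfl⟩
      have := hψ (⟨a i, Subgroup.subset_closure ⟨i, rfl⟩⟩ * q.out)
      rw [Subgroup.coe_mul, flagAct_mul] at this
      exact this
  · rintro ⟨S, hSfin, ⟨F, hFS⟩, -, hSflag, hSinv⟩
    have hpres : ∀ g ∈ Subgroup.closure (Set.range a), ∀ V ∈ S, flagAct g V ∈ S := by
      intro g hg
      induction hg using Subgroup.closure_induction with
      | mem x hx =>
        obtain ⟨i, rfl⟩ := hx
        exact hSinv i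
      | one => intro V hV; rwa [flagAct_one]
      | mul x y _ _ hx hy => intro V hV; rw [flagAct_mul]; exact hx _ (hy _ hV)
      | inv x _ hx =>
        intro V hV
        have hinj : Set.InjOn (flagAct x) S := by
          intro A _ B _ hAB
          have := congrArg (flagAct x⁻¹) hAB
          rwa [← flagAct_mul, ← flagAct_mul, inv_mul_cancel, flagAct_one, flagAct_one] at this
        obtain ⟨U, hU, rfl⟩ := ((hSfin.injOn_iff_bijOn_of_mapsTo hx).1 hinj).surjOn hV
        rwa [← flagAct_mul, inv_mul_cancel, flagAct_one]
    let P : Subgroup (Subgroup.closure (Set.range a)) :=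
      { carrier := {g | flagAct (g : GL (Fin d) ℂ) F = F}
        mul_mem' := by
          intro x y hx hy
          simp only [Set.mem_ofPred_eq, Subgroup.coe_mul] at *
          rw [flagAct_mul, hy, hx]
        one_mem' := by
          simp only [Set.mem_ofPred_eq, Subgroup.coe_one]
          exact flagAct_one F
        inv_mem' := by
          intro x hx
          simp only [Set.mem_ofPred_eq, Subgroup.coe_inv] at *
          nth_rewrite 1 [← hx]
          rw [← flagAct_mul, inv_mul_cancel, flagAct_one] }
    have hP : ∀ g, g ∈ P ↔ flagAct (g : GL (Fin d) ℂ) F = F := fun g => Iff.rfl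
    refine ⟨P, ⟨(index_le_of_sep P S.ncard ?_).1⟩, ?_⟩
    · intro T hT
      have hinj : Set.InjOn (fun g : Subgroup.closure (Set.range a) =>
          flagAct (g : GL (Fin d) ℂ) F) T := by
        intro x hx y hy hxy
        by_contra hne
        apply hT x hx y hy hne
        simp only at hxy
        rw [hP, Subgroup.coe_mul, flagAct_mul, ← hxy, ← flagAct_mul, Subgroup.coe_inv,
          inv_mul_cancel, flagAct_one]
      rw [← Set.ncard_coe_finset, ← Set.InjOn.ncard_image hinj]
      apply Set.ncard_le_ncard _ hSfin
      rintro _ ⟨g, -, rfl⟩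
      exact hpres g g.2 F hFS
    · have hF := hSflag F hFS
      refine solvable_of_flag
        (((stdRep d).comp (Subgroup.closure (Set.range a)).subtype).comp P.subtype) ?_
        (fun j => if h : j < d + 1 then F ⟨j, h⟩ else ⊤) d (by simp) ?_ ?_ ?_
      · exact (stdRep_injective d).comp
          ((Subgroup.subtype_injective _).comp (Subgroup.subtype_injective _))
      · intro j hj
        rw [dif_pos (by omega : j < d + 1)]
        exact hF.2 _
      · intro j hj
        rw [dif_pos (by omega : j < d + 1), dif_pos (by omega : j + 1 < d + 1)]
        exact hF.1 (by simp)
      · intro j hj g w hw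
        rw [dif_pos (by omega : j < d + 1)] at hw ⊢
        have := congrFun ((hP g.1).1 g.2) ⟨j, by omega⟩
        rw [← this]
        exact Submodule.mem_map_of_mem hw
end
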